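/- arXiv:1904.09070 — 4 statements merged into one kernel-verified Lean document; each statement's English description precedes it below -/
import Mathlib

section
/- ∫₀^∞ cos(π x²)/cosh(π x) dx = 1/(2√2). -/
open Real MeasureTheory

noncomputable def cc : ℂ := -Complex.I * (Complex.exp (Complex.I * π / 4) - 1)

noncomputable def NN (z : ℂ) : ℂ :=
  Complex.exp (Complex.I * π * z ^ 2 + π * z) - 1 - cc * Complex.sinh (π * z)

lemma factor_zero (F : ℂ → ℂ) (hF : Differentiable ℂ F) (a : ℂ) (h : F a = 0) :
    ∃ M : ℂ → ℂ, Differentiable ℂ M ∧ ∀ z, F z = (z - a) * M z := by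
  refine ⟨dslope F a, ?_, fun z => ?_⟩
  · rw [← differentiableOn_univ]
    exact (Complex.differentiableOn_dslope Filter.univ_mem).2 hF.differentiableOn
  · have := sub_smul_dslope F a z
    rw [h, sub_zero, smul_eq_mul] at this
    exact this.symm

lemma factor_three (F : ℂ → ℂ) (hF : Differentiable ℂ F) (a b c : ℂ) (hab : a ≠ b) (hac : a ≠ c)
    (hbc : b ≠ c) (ha : F a = 0) (hb : F b = 0) (hc : F c = 0) :
    ∃ M : ℂ → ℂ, Differentiable ℂ M ∧ ∀ z, F z = ((z - a) * (z - b) * (z - c)) * M z := by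
  obtain ⟨M, hM, h1⟩ := factor_zero F hF a ha
  have hb' : M b = 0 := by
    rw [h1] at hb
    exact (mul_eq_zero.1 hb).resolve_left (sub_ne_zero.2 hab.symm)
  obtain ⟨M2, hM2, h2⟩ := factor_zero M hM b hb'
  have hc' : M2 c = 0 := by
    rw [h1, h2] at hc
    exact ((mul_eq_zero.1 hc).resolve_left (sub_ne_zero.2 hac.symm) |> mul_eq_zero.1).resolve_left
      (sub_ne_zero.2 hbc.symm)
  obtain ⟨M3, hM3, h3⟩ := factor_zero M2 hM2 c hc'
  exact ⟨M3, hM3, fun z => by rw [h1, h2, h3]; ring⟩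

lemma NN_diff : Differentiable ℂ NN := by unfold NN; fun_prop

lemma NN_zero : NN 0 = 0 := by simp [NN]

lemma NN_half : NN (Complex.I / 2) = 0 := by
  have h1 : Complex.I * π * (Complex.I / 2) ^ 2 + π * (Complex.I / 2) = Complex.I * π / 4 := by
    ring_nf; simp; ring
  have h2 : Complex.sinh (π * (Complex.I / 2)) = Complex.I := by
    rw [show (π : ℂ) * (Complex.I / 2) = (π / 2 : ℂ) * Complex.I by ring, Complex.sinh_mul_I]
    simp
  rw [NN, h1, h2, cc]
  linear_combination (Complex.exp (Complex.I * π / 4) - 1) * Complex.I_mul_I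

lemma NN_one : NN Complex.I = 0 := by
  have h1 : Complex.I * π * Complex.I ^ 2 + π * Complex.I = 0 := by
    linear_combination (Complex.I * π) * Complex.I_mul_I
  rw [NN, h1, Complex.sinh_mul_I]
  simp

lemma sinh_zeros (z : ℂ) (h : Complex.sinh (2 * π * z) = 0) (h0 : 0 ≤ z.im) (h1 : z.im ≤ 1) :
    z = 0 ∨ z = Complex.I / 2 ∨ z = Complex.I := by
  have h2 : Complex.sin (2 * π * z * Complex.I) = 0 := by rw [Complex.sin_mul_I, h]; simp
  obtain ⟨k, hk⟩ := Complex.sin_eq_zero_iff.1 h2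
  have hpi : (π : ℂ) ≠ 0 := by exact_mod_cast Real.pi_ne_zero
  have hz : z = -(k / 2 : ℂ) * Complex.I := by
    have : (π : ℂ) * (2 * z * Complex.I - k) = 0 := by linear_combination hk
    have := (mul_eq_zero.1 this).resolve_left hpi
    linear_combination (-Complex.I/2) * this + z * Complex.I_mul_I
  have him : z.im = -(k / 2 : ℝ) := by
    rw [hz]
    have : -(k / 2 : ℂ) = ((-(k / 2 : ℝ) : ℝ) : ℂ) := by push_cast; ring
    rw [this, Complex.im_ofReal_mul, Complex.I_im, mul_one]
  have k0 : k ≤ 0 := by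
    have : (k : ℝ) ≤ 0 := by linarith
    exact_mod_cast this
  have k1 : -2 ≤ k := by
    have : (-2 : ℝ) ≤ k := by linarith
    exact_mod_cast this
  have : k = 0 ∨ k = -1 ∨ k = -2 := by omega
  rcases this with rfl | rfl | rfl
  · left; simp [hz]
  · right; left; rw [hz]; push_cast; ring
  · right; right; rw [hz]; push_cast; ring

lemma exists_G : ∃ G : ℂ → ℂ, (∀ z : ℂ, 0 ≤ z.im → z.im ≤ 1 → DifferentiableAt ℂ G z) ∧
    ∀ z : ℂ, Complex.sinh (2 * π * z) ≠ 0 → G z = NN z / Complex.sinh (2 * π * z) := by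
  have e1 : (0 : ℂ) ≠ Complex.I / 2 := (div_ne_zero Complex.I_ne_zero two_ne_zero).symm
  have e2 : (0 : ℂ) ≠ Complex.I := Complex.I_ne_zero.symm
  have e3 : Complex.I / 2 ≠ Complex.I := by
    intro h
    have := congrArg Complex.im h
    norm_num at this
  obtain ⟨M, hM, hM'⟩ := factor_three NN NN_diff 0 (Complex.I / 2) Complex.I e1 e2 e3
    NN_zero NN_half NN_one
  have hsd : Differentiable ℂ (fun z : ℂ => Complex.sinh (2 * π * z)) := by fun_prop
  have s0 : Complex.sinh (2 * π * 0) = 0 := by simp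
  have s1 : Complex.sinh (2 * π * (Complex.I / 2)) = 0 := by
    rw [show 2 * (π : ℂ) * (Complex.I / 2) = π * Complex.I by ring, Complex.sinh_mul_I]; simp
  have s2 : Complex.sinh (2 * π * Complex.I) = 0 := by
    rw [Complex.sinh_mul_I]; simp
  obtain ⟨S, hS, hS'⟩ := factor_three (fun z : ℂ => Complex.sinh (2 * π * z)) hsd
    0 (Complex.I / 2) Complex.I e1 e2 e3 s0 s1 s2
  have key : ∀ z : ℂ, 0 ≤ z.im → z.im ≤ 1 → S z ≠ 0 := by
    intro z h0 h1 hz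
    have hs : Complex.sinh (2 * π * z) = 0 := by rw [hS' z, hz, mul_zero]
    have d1 : HasDerivAt (fun z : ℂ => Complex.sinh (2 * π * z))
        (Complex.cosh (2 * π * z) * (2 * π * 1)) z :=
      ((hasDerivAt_id z).const_mul (2 * π : ℂ)).csinh
    have d2 : HasDerivAt (fun z : ℂ => ((z - 0) * (z - Complex.I / 2) * (z - Complex.I)) * S z)
        (deriv (fun z : ℂ => ((z - 0) * (z - Complex.I / 2) * (z - Complex.I))) z * S z +
          ((z - 0) * (z - Complex.I / 2) * (z - Complex.I)) * deriv S z) z :=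
      HasDerivAt.mul (DifferentiableAt.hasDerivAt (by fun_prop)) (hS z).hasDerivAt
    have hP : (z - 0) * (z - Complex.I / 2) * (z - Complex.I) = 0 := by
      rcases sinh_zeros z hs h0 h1 with h | h | h <;> simp [h]
    rw [← funext hS', hz, hP] at d2
    have := d1.unique d2
    have hcs := Complex.cosh_sq (2 * π * z)
    rw [hs] at hcs
    have hpi : (π : ℂ) ≠ 0 := by exact_mod_cast Real.pi_ne_zero
    have hc : Complex.cosh (2 * π * z) = 0 := by simpa [hpi] using this
    rw [hc] at hcs
    norm_num at hcs
  refine ⟨fun z => M z / S z, fun z h0 h1 => (hM z).div (hS z) (key z h0 h1), fun z hz => ?_⟩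
  have := hS' z
  rw [this] at hz ⊢
  rw [hM']
  exact (mul_div_mul_left _ _ (left_ne_zero_of_mul hz)).symm

lemma norm_sinh_ge (w : ℂ) : Real.sinh |w.re| ≤ ‖Complex.sinh w‖ := by
  have h1 := norm_sub_norm_le (Complex.exp w) (Complex.exp (-w))
  have h2 := norm_sub_norm_le (Complex.exp (-w)) (Complex.exp w)
  rw [norm_sub_rev] at h2
  rw [Complex.sinh, norm_div]
  simp only [Complex.norm_exp, Complex.neg_re] at h1 h2
  have : ‖(2:ℂ)‖ = 2 := by simp
  rw [this, Real.sinh_eq]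
  rcases abs_cases w.re with ⟨h, _⟩ | ⟨h, _⟩ <;> rw [h] <;> try rw [neg_neg]
  all_goals linarith

lemma norm_sinh_le (w : ℂ) : ‖Complex.sinh w‖ ≤ Real.exp |w.re| := by
  have h1 := norm_sub_le (Complex.exp w) (Complex.exp (-w))
  rw [Complex.sinh, norm_div]
  simp only [Complex.norm_exp, Complex.neg_re] at h1
  have : ‖(2:ℂ)‖ = 2 := by simp
  rw [this]
  have a1 := Real.exp_le_exp.2 (le_abs_self w.re)
  have a2 := Real.exp_le_exp.2 (neg_le_abs w.re)
  linarith

lemma norm_NN_le (x y : ℝ) (h0 : 0 ≤ y) (h1 : y ≤ 1) :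
    ‖NN (x + y * Complex.I)‖ ≤ (2 + ‖cc‖) * Real.exp (π * |x|) := by
  have hE : ‖Complex.exp (Complex.I * π * (x + y * Complex.I) ^ 2 + π * (x + y * Complex.I))‖ ≤
      Real.exp (π * |x|) := by
    rw [Complex.norm_exp, Real.exp_le_exp]
    have : (Complex.I * π * (x + y * Complex.I) ^ 2 + π * (x + y * Complex.I)).re
      = π * (x * (1 - 2 * y)) := by
      simp [pow_two]; ring
    rw [this]
    refine mul_le_mul_of_nonneg_left ?_ Real.pi_pos.le
    calc x * (1 - 2 * y) ≤ |x * (1 - 2 * y)| := le_abs_self _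
      _ = |x| * |1 - 2 * y| := abs_mul _ _
      _ ≤ |x| * 1 := by
        refine mul_le_mul_of_nonneg_left ?_ (abs_nonneg x)
        rw [abs_le]; constructor <;> linarith
      _ = |x| := mul_one _
  have hs := norm_sinh_le (π * (x + y * Complex.I))
  have hre : |(π * (x + y * Complex.I) : ℂ).re| = π * |x| := by
    simp [abs_mul, abs_of_pos Real.pi_pos]
  rw [hre] at hs
  have h1 : (1:ℝ) ≤ Real.exp (π * |x|) := Real.one_le_exp (by positivity)
  have hc := mul_le_mul_of_nonneg_left hs (norm_nonneg cc)
  unfold NN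
  refine (norm_sub_le _ _).trans ?_
  have := norm_sub_le (Complex.exp (Complex.I * π * (x + y * Complex.I) ^ 2 + π * (x + y * Complex.I))) 1
  rw [norm_mul]
  rw [norm_one] at this
  linarith

lemma G_diff_id (x : ℝ) (hx : x ≠ 0) :
    NN x / Complex.sinh (2 * π * x) - NN (x + Complex.I) / Complex.sinh (2 * π * (x + Complex.I))
    = (Complex.exp (Complex.I * π * x ^ 2) - cc) / Complex.cosh (π * x) := by
  have hs : Complex.sinh (π * x) ≠ 0 := by
    have : Real.sinh (π * x) ≠ 0 := by
      rw [Ne, Real.sinh_eq_zero]; exact mul_ne_zero Real.pi_ne_zero hx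
    exact_mod_cast this
  have hc : Complex.cosh (π * x) ≠ 0 := by
    have : Real.cosh (π * x) ≠ 0 := (Real.cosh_pos _).ne'
    exact_mod_cast this
  have e1 : Complex.sinh (2 * π * (x + Complex.I)) = Complex.sinh (2 * π * x) := by
    rw [mul_add, Complex.sinh_add, Complex.sinh_mul_I, Complex.cosh_mul_I]; simp
  have e2 : Complex.sinh (π * (x + Complex.I)) = - Complex.sinh (π * x) := by
    rw [mul_add, Complex.sinh_add, Complex.sinh_mul_I, Complex.cosh_mul_I]; simp
  have e3 : Complex.exp (Complex.I * π * (x + Complex.I) ^ 2 + π * (x + Complex.I)) =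
      Complex.exp (Complex.I * π * x ^ 2) * Complex.exp (-(π * x)) := by
    rw [← Complex.exp_add]; congr 1
    linear_combination (2 * π * x + π * Complex.I) * Complex.I_mul_I
  have e4 : Complex.sinh (2 * π * x) = 2 * Complex.sinh (π * x) * Complex.cosh (π * x) := by
    rw [← Complex.sinh_two_mul]; congr 1; ring
  rw [e1, NN, NN, e2, e3, e4, Complex.exp_add]
  have e5 : Complex.exp (π * x) = Complex.exp (-(π * x)) + 2 * Complex.sinh (π * x) := by
    rw [Complex.sinh]; ring
  rw [e5]
  field_simp
  ring

noncomputable def gg (x : ℝ) : ℝ := (Real.cos (π * x ^ 2) - √2 / 2) / Real.cosh (π * x)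

lemma cc_re : cc.re = √2 / 2 := by
  have : Complex.exp (Complex.I * π / 4) = (√2 / 2 : ℝ) + (√2 / 2 : ℝ) * Complex.I := by
    rw [show Complex.I * (π : ℂ) / 4 = ((π / 4 : ℝ) : ℂ) * Complex.I by push_cast; ring,
      Complex.exp_mul_I, ← Complex.ofReal_cos, ← Complex.ofReal_sin, Real.cos_pi_div_four,
      Real.sin_pi_div_four]
  rw [cc, this]
  simp [-Complex.ofReal_div]

lemma gg_eq (x : ℝ) :
    ((Complex.exp (Complex.I * π * x ^ 2) - cc) / Complex.cosh (π * x)).re = gg x := by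
  have : Complex.cosh (π * x) = ((Real.cosh (π * x) : ℝ) : ℂ) := by push_cast; rfl
  rw [this, Complex.div_ofReal_re, gg, Complex.sub_re, cc_re]
  rw [show Complex.I * (π : ℂ) * x ^ 2 = ((π * x ^ 2 : ℝ) : ℂ) * Complex.I by push_cast; ring,
    Complex.exp_ofReal_mul_I_re]

lemma side_bound (G : ℂ → ℂ)
    (hG : ∀ z : ℂ, Complex.sinh (2 * π * z) ≠ 0 → G z = NN z / Complex.sinh (2 * π * z))
    (x : ℝ) (hx : x ≠ 0) :
    ‖∫ y in (0:ℝ)..1, G (x + y * Complex.I)‖ ≤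
      (2 + ‖cc‖) * Real.exp (π * |x|) / Real.sinh (2 * π * |x|) := by
  have hpos : 0 < Real.sinh (2 * π * |x|) := by
    rw [Real.sinh_pos_iff]; have := Real.pi_pos; positivity
  have := intervalIntegral.norm_integral_le_of_norm_le_const (a := (0:ℝ)) (b := 1)
    (f := fun y : ℝ => G (x + y * Complex.I))
    (C := (2 + ‖cc‖) * Real.exp (π * |x|) / Real.sinh (2 * π * |x|)) ?_
  · simpa using this
  · intro y hy
    rw [Set.uIoc_of_le zero_le_one] at hy
    have h2 := norm_sinh_ge (2 * π * (x + y * Complex.I))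
    have hre : |(2 * π * (x + y * Complex.I) : ℂ).re| = 2 * π * |x| := by
      simp [abs_mul, abs_of_pos Real.pi_pos]
    rw [hre] at h2
    have hne : Complex.sinh (2 * π * (x + y * Complex.I)) ≠ 0 :=
      norm_pos_iff.1 (hpos.trans_le h2)
    rw [hG _ hne, norm_div]
    exact div_le_div₀ (by positivity) (norm_NN_le x y hy.1.le hy.2) hpos h2

lemma gg_cont : Continuous gg := by
  unfold gg
  refine Continuous.div (by fun_prop) (by fun_prop) (fun x => (Real.cosh_pos _).ne')

lemma gg_bound (T : ℝ) (hT : 0 < T) :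
    |∫ x in (-T)..T, gg x| ≤ 2 * ((2 + ‖cc‖) * Real.exp (π * T) / Real.sinh (2 * π * T)) := by
  obtain ⟨G, hGd, hG⟩ := exists_G
  have hsn : ∀ x : ℝ, x ≠ 0 → Complex.sinh (2 * π * x) ≠ 0 := by
    intro x hx
    have : Real.sinh (2 * π * x) ≠ 0 := by
      rw [Ne, Real.sinh_eq_zero]
      exact mul_ne_zero (mul_ne_zero two_ne_zero Real.pi_ne_zero) hx
    exact_mod_cast this
  have hper : ∀ x : ℝ, Complex.sinh (2 * π * (x + Complex.I)) = Complex.sinh (2 * π * x) := by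
    intro x
    rw [mul_add, Complex.sinh_add, Complex.sinh_mul_I, Complex.cosh_mul_I]; simp
  have hR := Complex.integral_boundary_rect_eq_zero_of_differentiableOn G (-T : ℝ)
    ((T : ℝ) + Complex.I) (by
      intro z hz
      have him := hz.2
      simp [Set.uIcc_of_le] at him
      exact (hGd z him.1 him.2).differentiableWithinAt)
  simp only [Complex.ofReal_re, Complex.ofReal_im, Complex.add_re, Complex.add_im, Complex.I_re,
    Complex.I_im, add_zero, zero_add, Complex.ofReal_zero, Complex.ofReal_one, zero_mul,
    one_mul, smul_eq_mul] at hR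
  have c1 : IntervalIntegrable (fun x : ℝ => G x) volume (-T) T := by
    apply Continuous.intervalIntegrable
    rw [continuous_iff_continuousAt]
    intro x
    exact ContinuousAt.comp (g := G) (hGd x (by simp) (by simp)).continuousAt
      Complex.continuous_ofReal.continuousAt
  have c2 : IntervalIntegrable (fun x : ℝ => G (x + Complex.I)) volume (-T) T := by
    apply Continuous.intervalIntegrable
    rw [continuous_iff_continuousAt]
    intro x
    exact ContinuousAt.comp (g := G) (f := fun x : ℝ => (x : ℂ) + Complex.I)
      (hGd _ (by simp) (by simp)).continuousAt (by fun_prop)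
  rw [← intervalIntegral.integral_sub c1 c2] at hR
  have hae : ∫ x in (-T)..T, (G x - G (x + Complex.I)) = ∫ x in (-T)..T,
      (Complex.exp (Complex.I * π * x ^ 2) - cc) / Complex.cosh (π * x) := by
    apply intervalIntegral.integral_congr_ae
    have : ∀ᵐ x : ℝ, x ≠ 0 := by simp [ae_iff]
    filter_upwards [this] with x hx _
    rw [hG _ (hsn x hx), hG _ (by rw [hper]; exact hsn x hx)]
    exact G_diff_id x hx
  rw [hae] at hR
  have c3 : IntervalIntegrable (fun x : ℝ => (Complex.exp (Complex.I * π * x ^ 2) - cc) /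
      Complex.cosh (π * x)) volume (-T) T := by
    apply Continuous.intervalIntegrable
    refine Continuous.div (by fun_prop) (by fun_prop) (fun x => ?_)
    have : Real.cosh (π * x) ≠ 0 := (Real.cosh_pos _).ne'
    exact_mod_cast this
  have hre := Complex.reCLM.intervalIntegral_comp_comm c3
  simp only [Complex.reCLM_apply, gg_eq] at hre
  rw [hre]
  refine (Complex.abs_re_le_norm _).trans ?_
  have b1 := side_bound G hG T hT.ne'
  have b2 := side_bound G hG (-T) (neg_ne_zero.2 hT.ne')
  rw [abs_neg, abs_of_pos hT] at b2
  rw [abs_of_pos hT] at b1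
  have : ∫ x in (-T)..T, (Complex.exp (Complex.I * π * x ^ 2) - cc) / Complex.cosh (π * x) =
    Complex.I * (∫ y in (0:ℝ)..1, G ((-T : ℝ) + y * Complex.I)) -
    Complex.I * (∫ y in (0:ℝ)..1, G (T + y * Complex.I)) := by
    linear_combination hR
  rw [this]
  refine (norm_sub_le _ _).trans ?_
  rw [norm_mul, norm_mul, Complex.norm_I, one_mul, one_mul]
  linarith

open Filter in
lemma sinh_top : Tendsto Real.sinh atTop atTop := by
  refine tendsto_atTop_mono' atTop ?_ tendsto_id
  filter_upwards [eventually_ge_atTop 0] with x hx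
  exact Real.self_le_sinh_iff.2 hx

open Filter Topology in
lemma bound_tendsto : Tendsto (fun T : ℝ => 2 * ((2 + ‖cc‖) * Real.exp (π * T) /
    Real.sinh (2 * π * T))) atTop (𝓝 0) := by
  have h : Tendsto (fun T : ℝ => 2 * (2 + ‖cc‖) * (1 / Real.sinh (π * T))) atTop (𝓝 0) := by
    rw [← mul_zero (2 * (2 + ‖cc‖))]
    apply Tendsto.const_mul
    simp only [one_div]
    apply Tendsto.inv_tendsto_atTop
    exact sinh_top.comp (tendsto_id.const_mul_atTop Real.pi_pos)
  refine squeeze_zero' ?_ ?_ h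
  · filter_upwards [eventually_gt_atTop 0] with T hT
    have : 0 < Real.sinh (2 * π * T) := by
      rw [Real.sinh_pos_iff]; have := Real.pi_pos; positivity
    positivity
  · filter_upwards [eventually_gt_atTop 0] with T hT
    have h1 : 0 < Real.sinh (π * T) := by
      rw [Real.sinh_pos_iff]; have := Real.pi_pos; positivity
    have h2 := Real.cosh_pos (π * T)
    have e : Real.sinh (2 * π * T) = 2 * Real.sinh (π * T) * Real.cosh (π * T) := by
      rw [← Real.sinh_two_mul]; congr 1; ring
    have h3 : Real.exp (π * T) ≤ 2 * Real.cosh (π * T) := by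
      rw [Real.cosh_eq]; have := Real.exp_pos (-(π * T)); linarith
    rw [e, mul_assoc 2 (2 + ‖cc‖), mul_div_assoc]
    refine mul_le_mul_of_nonneg_left (mul_le_mul_of_nonneg_left ?_ (by positivity)) (by norm_num)
    rw [div_le_div_iff₀ (by positivity) h1]
    nlinarith

lemma hd (x : ℝ) : HasDerivAt (fun x => (1 / π) * Real.arctan (Real.sinh (π * x)))
    (1 / Real.cosh (π * x)) x := by
  have h := ((((hasDerivAt_id x).const_mul π).sinh).arctan).const_mul (1 / π)
  refine h.congr_deriv ?_
  have := Real.cosh_sq (π * x)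
  have h2 := Real.cosh_pos (π * x)
  have hp := Real.pi_pos
  simp only [id]
  rw [add_comm 1, ← this]
  field_simp

open Filter Topology in
lemma ht : Tendsto (fun x => (1 / π) * Real.arctan (Real.sinh (π * x))) atTop (𝓝 (1 / 2)) := by
  have : (1 / 2 : ℝ) = (1 / π) * (π / 2) := by have := Real.pi_pos; field_simp
  rw [this]
  apply Tendsto.const_mul
  exact (tendsto_nhds_of_tendsto_nhdsWithin Real.tendsto_arctan_atTop).comp
    (sinh_top.comp (tendsto_id.const_mul_atTop Real.pi_pos))

lemma sech_int : IntegrableOn (fun x => 1 / Real.cosh (π * x)) (Set.Ioi 0) :=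
  integrableOn_Ioi_deriv_of_nonneg' (fun x _ => hd x)
    (fun x _ => by have := Real.cosh_pos (π * x); positivity) ht

lemma sech_val : ∫ x in Set.Ioi (0:ℝ), 1 / Real.cosh (π * x) = 1 / 2 := by
  rw [integral_Ioi_of_hasDerivAt_of_tendsto' (fun x _ => hd x) sech_int ht]
  simp

theorem stmt7 :
    ∫ x in Set.Ioi (0:ℝ), Real.cos (π * x ^ 2) / Real.cosh (π * x) = 1 / (2 * Real.sqrt 2) := by
  have i1 : IntegrableOn (fun x => Real.cos (π * x ^ 2) / Real.cosh (π * x)) (Set.Ioi 0) := by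
    refine Integrable.mono' sech_int ?_ ?_
    · apply Continuous.aestronglyMeasurable
      exact Continuous.div (by fun_prop) (by fun_prop) (fun x => (Real.cosh_pos _).ne')
    · refine Filter.Eventually.of_forall (fun x => ?_)
      have := Real.cosh_pos (π * x)
      rw [Real.norm_eq_abs, abs_div, abs_of_pos this]
      exact div_le_div_of_nonneg_right (Real.abs_cos_le_one _) this.le
  have hg : gg = fun x => Real.cos (π * x ^ 2) / Real.cosh (π * x) -
      √2 / 2 * (1 / Real.cosh (π * x)) := by
    funext x; rw [gg]; ring
  have i2 : IntegrableOn gg (Set.Ioi 0) := by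
    rw [hg]; exact i1.sub (sech_int.const_mul _)
  have t1 := intervalIntegral_tendsto_integral_Ioi 0 i2 Filter.tendsto_id
  have ev : ∀ T : ℝ, ∫ x in (-T)..T, gg x = 2 * ∫ x in (0:ℝ)..T, gg x := by
    intro T
    have h := intervalIntegral.integral_comp_neg (a := 0) (b := T) gg
    have h' : ∀ x, gg (-x) = gg x := fun x => by simp [gg]
    simp only [h', neg_zero] at h
    rw [← intervalIntegral.integral_add_adjacent_intervals
      (gg_cont.intervalIntegrable (-T) 0) (gg_cont.intervalIntegrable 0 T), ← h]
    ring
  have t2 : Filter.Tendsto (fun T : ℝ => ∫ x in (-T)..T, gg x) Filter.atTop (nhds 0) := by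
    refine squeeze_zero_norm' ?_ bound_tendsto
    filter_upwards [Filter.eventually_gt_atTop 0] with T hT
    exact gg_bound T hT
  simp only [ev] at t2
  have h0 := tendsto_nhds_unique (t1.const_mul 2) t2
  have h1 : ∫ x in Set.Ioi (0:ℝ), gg x = 0 := by linarith
  rw [hg, integral_sub i1 (sech_int.const_mul _), integral_const_mul, sech_val] at h1
  rw [sub_eq_zero.1 h1]
  have h2 : √2 * √2 = 2 := Real.mul_self_sqrt (by norm_num)
  have h3 : 0 < √2 := by positivity
  rw [eq_div_iff (by positivity)]
  linear_combination h2 / 2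
end

section
/- ∫₀^∞ cos(π x²)/(1 + 2·cosh(2π x/√3)) dx = (2 − √6 + √2)/8. -/
open Real MeasureTheory

namespace Mordell
open Complex Filter Topology

noncomputable def E (z : ℂ) : ℂ := cexp (I * π * z ^ 2)
noncomputable def W (z : ℂ) : ℂ := cexp ((2 * π / Real.sqrt 3 : ℝ) * z)
noncomputable def Q (p z : ℂ) : ℂ := dslope E p z / dslope W p z
def S : Set ℂ := {z | 0 ≤ z.im ∧ z.im ≤ Real.sqrt 3}
noncomputable def P (k : ℝ) : ℂ := (Real.sqrt 3 * k / 6 : ℝ) * I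
noncomputable def w : ℂ := 1 / 2 + (Real.sqrt 3 / 2 : ℝ) * I

noncomputable def H (z : ℂ) : ℂ := w / 6 * Q (P 1) z + (1 + w) / 6 * Q (P 2) z + 2 / 6 * Q (P 3) z
  + (2 - w) / 6 * Q (P 4) z + (1 - w) / 6 * Q (P 5) z

lemma s3pos : 0 < Real.sqrt 3 := by positivity
lemma s3sq : Real.sqrt 3 ^ 2 = 3 := Real.sq_sqrt (by norm_num)

lemma E_diff : Differentiable ℂ E := by unfold E; fun_prop
lemma W_diff : Differentiable ℂ W := by unfold W; fun_prop

lemma W_deriv (p : ℂ) : deriv W p ≠ 0 := by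
  have : HasDerivAt W (cexp ((2 * π / Real.sqrt 3 : ℝ) * p) * ((2 * π / Real.sqrt 3 : ℝ) * 1)) p :=
    ((hasDerivAt_id p).const_mul _).cexp
  rw [this.deriv]
  have h : (2 * π / Real.sqrt 3 : ℝ) ≠ 0 := by positivity
  simp only [mul_one]
  exact mul_ne_zero (Complex.exp_ne_zero _) (by exact_mod_cast h)

lemma W_inj {p z : ℂ} (h0 : 0 < p.im) (h1 : p.im < Real.sqrt 3) (hz : z ∈ S) (h : W z = W p) :
    z = p := by
  unfold W at h
  rw [Complex.exp_eq_exp_iff_exists_int] at h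
  obtain ⟨n, hn⟩ := h
  have hs := s3pos
  have hc : (2 * π / Real.sqrt 3 : ℝ) ≠ 0 := by positivity
  have him := congrArg Complex.im hn
  have e : ((n : ℂ) * (2 * π * I)).im = n * (2 * π) := by
    have : (n : ℂ) * (2 * π * I) = ((n * (2 * π) : ℝ) : ℂ) * I := by push_cast; ring
    rw [this]; simp
  rw [Complex.add_im, Complex.im_ofReal_mul, Complex.im_ofReal_mul, e] at him
  have h2 : z.im = p.im + n * Real.sqrt 3 := by
    field_simp at him
    linarith
  obtain ⟨a, b⟩ := hz
  have hn0 : n = 0 := by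
    have l1 : (n : ℝ) < 1 := by nlinarith
    have l2 : (-1 : ℝ) < n := by nlinarith
    have l1' : n < 1 := by exact_mod_cast l1
    have l2' : -1 < n := by exact_mod_cast l2
    omega
  rw [hn0] at hn
  have hc' : ((2 * π / Real.sqrt 3 : ℝ) : ℂ) ≠ 0 := by exact_mod_cast hc
  apply mul_left_cancel₀ hc'
  simpa using hn

lemma dslope_ne {p z : ℂ} (h0 : 0 < p.im) (h1 : p.im < Real.sqrt 3) (hz : z ∈ S) :
    dslope W p z ≠ 0 := by
  by_cases h : z = p
  · subst h; rw [dslope_same]; exact W_deriv _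
  · rw [dslope_of_ne _ h, slope_def_field]
    refine div_ne_zero (sub_ne_zero.2 fun h' => h (W_inj h0 h1 hz h')) (sub_ne_zero.2 h)

lemma dslope_diff {f : ℂ → ℂ} (hf : Differentiable ℂ f) (p : ℂ) : Differentiable ℂ (dslope f p) := by
  rw [← differentiableOn_univ] at *
  exact (Complex.differentiableOn_dslope Filter.univ_mem).2 hf

lemma Q_diff {p z : ℂ} (h0 : 0 < p.im) (h1 : p.im < Real.sqrt 3) (hz : z ∈ S) :
    DifferentiableAt ℂ (Q p) z := by
  unfold Q
  exact (dslope_diff E_diff p z).div (dslope_diff W_diff p z) (dslope_ne h0 h1 hz)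

lemma Q_eq {p z : ℂ} (h : W z ≠ W p) : Q p z = (E z - E p) / (W z - W p) := by
  have hzp : z ≠ p := fun h' => h (by rw [h'])
  unfold Q
  rw [dslope_of_ne _ hzp, dslope_of_ne _ hzp, slope_def_field, slope_def_field]
  have := sub_ne_zero.2 hzp
  have := sub_ne_zero.2 h
  field_simp

lemma P_im (k : ℝ) : (P k).im = Real.sqrt 3 * k / 6 := by
  unfold P
  rw [Complex.im_ofReal_mul]; simp

lemma P_im0 {k : ℝ} (h : 0 < k) : 0 < (P k).im := by
  rw [P_im]; positivity
lemma P_im1 {k : ℝ} (h : k < 6) : (P k).im < Real.sqrt 3 := by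
  rw [P_im]; have := s3pos; nlinarith

lemma H_diff {z : ℂ} (hz : z ∈ S) : DifferentiableAt ℂ H z := by
  unfold H
  have h1 : DifferentiableAt ℂ (Q (P 1)) z := Q_diff (P_im0 (by norm_num)) (P_im1 (by norm_num)) hz
  have h2 : DifferentiableAt ℂ (Q (P 2)) z := Q_diff (P_im0 (by norm_num)) (P_im1 (by norm_num)) hz
  have h3 : DifferentiableAt ℂ (Q (P 3)) z := Q_diff (P_im0 (by norm_num)) (P_im1 (by norm_num)) hz
  have h4 : DifferentiableAt ℂ (Q (P 4)) z := Q_diff (P_im0 (by norm_num)) (P_im1 (by norm_num)) hz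
  have h5 : DifferentiableAt ℂ (Q (P 5)) z := Q_diff (P_im0 (by norm_num)) (P_im1 (by norm_num)) hz
  fun_prop

lemma w_sq : w ^ 2 = w - 1 := by
  have h : ((Real.sqrt 3 : ℝ) : ℂ) ^ 2 = 3 := by exact_mod_cast s3sq
  unfold w
  push_cast
  linear_combination (1/4 : ℂ) * I ^ 2 * h + (3/4 : ℂ) * I_sq

lemma W_P (k : ℝ) : W (P k) = cexp ((k * (π / 3) : ℝ) * I) := by
  unfold W P
  congr 1
  rw [← mul_assoc, ← Complex.ofReal_mul]
  congr 2
  have := s3pos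
  field_simp
  ring

lemma W_P1 : W (P 1) = w := by
  rw [W_P, one_mul, Complex.exp_mul_I, ← Complex.ofReal_cos, ← Complex.ofReal_sin,
    Real.cos_pi_div_three, Real.sin_pi_div_three]
  unfold w; push_cast; ring

lemma W_Pn (n : ℕ) : W (P n) = w ^ n := by
  rw [← W_P1, W_P, W_P, ← Complex.exp_nat_mul]
  congr 1; push_cast; ring

lemma W_P2 : W (P 2) = w - 1 := by
  have := W_Pn 2
  push_cast at this
  rw [this, w_sq]
lemma W_P3 : W (P 3) = -1 := by
  have := W_Pn 3
  push_cast at this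
  rw [this]; linear_combination (w + 1) * w_sq
lemma W_P4 : W (P 4) = -w := by
  have := W_Pn 4
  push_cast at this
  rw [this]; linear_combination (w^2 + w) * w_sq
lemma W_P5 : W (P 5) = 1 - w := by
  have := W_Pn 5
  push_cast at this
  rw [this]; linear_combination (w^3 + w^2 - 1) * w_sq

lemma E_P (k : ℝ) : E (P k) = cexp ((-(k ^ 2 * (π / 12)) : ℝ) * I) := by
  unfold E P
  congr 1
  have h : ((Real.sqrt 3 : ℝ) : ℂ) ^ 2 = 3 := by exact_mod_cast s3sq
  push_cast
  rw [show (I * π * ((Real.sqrt 3 : ℝ) * k / 6 * I) ^ 2 : ℂ) = I * π * k^2 / 36 * ((Real.sqrt 3 : ℝ) : ℂ)^2 * I ^ 2 by ring, h, I_sq]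
  ring

lemma pf {u : ℂ} (h1 : u - w ≠ 0) (h2 : u - (w - 1) ≠ 0) (h3 : u - (-1) ≠ 0)
    (h4 : u - (-w) ≠ 0) (h5 : u - (1 - w) ≠ 0) :
    w / 6 / (u - w) + (1 + w) / 6 / (u - (w - 1)) + 2 / 6 / (u - (-1))
      + (2 - w) / 6 / (u - (-w)) + (1 - w) / 6 / (u - (1 - w)) =
      u ^ 4 / ((1 + u + u ^ 2) * (1 + u ^ 3)) := by
  have hw := w_sq
  have e1 : (u - w) * (u - (1 - w)) = u ^ 2 - u + 1 := by linear_combination -hw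
  have e2 : (u - (w - 1)) * (u - (-w)) = u ^ 2 + u + 1 := by linear_combination -hw
  have n1 := mul_ne_zero h1 h5
  have n2 := mul_ne_zero h2 h4
  rw [e1] at n1
  rw [e2] at n2
  have f1 : w / 6 / (u - w) + (1 - w) / 6 / (u - (1 - w)) = (u - 2) / 6 / (u ^ 2 - u + 1) + 2 / 6 / (u ^ 2 - u + 1) * 0 + (w * (u - (1 - w)) + (1 - w) * (u - w) - (u - 2)) / 6 / (u ^ 2 - u + 1) := by
    rw [← e1]; field_simp; ring
  have f2 : (1 + w) / 6 / (u - (w - 1)) + (2 - w) / 6 / (u - (-w)) = ((1 + w) * (u - (-w)) + (2 - w) * (u - (w - 1))) / 6 / (u ^ 2 + u + 1) := by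
    rw [← e2]; field_simp
  have g1 : w * (u - (1 - w)) + (1 - w) * (u - w) - (u - 2) = 0 := by linear_combination 2 * hw
  have g2 : (1 + w) * (u - (-w)) + (2 - w) * (u - (w - 1)) = 3 * u := by linear_combination 2 * hw
  rw [g1] at f1
  rw [g2] at f2
  have n3 : 1 + u ^ 3 ≠ 0 := by
    rw [show 1 + u ^ 3 = (u - (-1)) * (u ^ 2 - u + 1) by ring]; exact mul_ne_zero h3 n1
  have n2' : 1 + u + u ^ 2 ≠ 0 := by convert n2 using 1; ring
  trans (u - 2) / 6 / (u ^ 2 - u + 1) + 3 * u / 6 / (u ^ 2 + u + 1) + 2 / 6 / (u - (-1))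
  · linear_combination f1 + f2
  · have h3' : u + 1 ≠ 0 := by simpa using h3
    rw [show 1 + u ^ 3 = (u + 1) * (u ^ 2 - u + 1) by ring,
      show u - (-1) = u + 1 by ring, show 1 + u + u ^ 2 = u ^ 2 + u + 1 by ring,
      div_div, div_div, div_div, div_add_div _ _ (by simpa using n1) (by simpa using n2),
      div_add_div _ _ (mul_ne_zero (by simpa using n1) (by simpa using n2)) (by simpa using h3'),
      div_eq_div_iff (by simp [n1, n2, h3']) (by simp [n1, n2, h3'])]
    ring

lemma W_per (z : ℂ) : W (z + Real.sqrt 3 * I) = W z := by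
  unfold W
  rw [Complex.exp_eq_exp_iff_exists_int]
  refine ⟨1, ?_⟩
  have : ((Real.sqrt 3 : ℝ) : ℂ) ≠ 0 := by exact_mod_cast s3pos.ne'
  push_cast
  field_simp

lemma E_per (z : ℂ) : E (z + Real.sqrt 3 * I) * W z ^ 3 = - E z := by
  unfold W E
  have h : ((Real.sqrt 3 : ℝ) : ℂ) ^ 2 = 3 := by exact_mod_cast s3sq
  have h0 : ((Real.sqrt 3 : ℝ) : ℂ) ≠ 0 := by exact_mod_cast s3pos.ne'
  rw [← Complex.exp_nat_mul, ← Complex.exp_add, ← Complex.exp_sub_pi_mul_I,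
    Complex.exp_eq_exp_iff_exists_int]
  refine ⟨-1, ?_⟩
  push_cast
  rw [show (2 * π / (Real.sqrt 3 : ℝ) : ℂ) = 2 * π * (Real.sqrt 3 : ℝ) / 3 by
    rw [← h]; field_simp]
  linear_combination (2 * π * Real.sqrt 3 * z + I * π * (Real.sqrt 3 : ℂ) ^ 2) * I_sq - I * π * h

lemma W_ne_P {z : ℂ} (hz : z ∈ S) {k : ℝ} (hk : 0 < k) (hk' : k < 6) (h : z ≠ P k) :
    W z ≠ W (P k) := fun h' => h (W_inj (P_im0 hk) (P_im1 hk') hz h')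

lemma H_eq {z : ℂ} (h1 : W z ≠ W (P 1)) (h2 : W z ≠ W (P 2)) (h3 : W z ≠ W (P 3))
    (h4 : W z ≠ W (P 4)) (h5 : W z ≠ W (P 5)) :
    H z = E z * (W z ^ 4 / ((1 + W z + W z ^ 2) * (1 + W z ^ 3))) -
      (w / 6 * E (P 1) / (W z - w) + (1 + w) / 6 * E (P 2) / (W z - (w - 1))
        + 2 / 6 * E (P 3) / (W z - (-1)) + (2 - w) / 6 * E (P 4) / (W z - (-w))
        + (1 - w) / 6 * E (P 5) / (W z - (1 - w))) := by
  unfold H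
  rw [Q_eq h1, Q_eq h2, Q_eq h3, Q_eq h4, Q_eq h5]
  rw [W_P1] at *
  rw [W_P2] at *
  rw [W_P3] at *
  rw [W_P4] at *
  rw [W_P5] at *
  rw [← pf (sub_ne_zero.2 h1) (sub_ne_zero.2 h2) (sub_ne_zero.2 h3) (sub_ne_zero.2 h4)
    (sub_ne_zero.2 h5)]
  ring

lemma H_edge (x : ℝ) : H x - H (x + Real.sqrt 3 * I) = E x * (W x / (1 + W x + W x ^ 2)) := by
  have hx : (x : ℂ) ∈ S := by simp [S]
  have key : ∀ k : ℝ, 0 < k → k < 6 → W x ≠ W (P k) := fun k h h' =>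
    W_ne_P hx h h' (fun he => by
      have := P_im0 h
      rw [← he] at this
      simp at this)
  have h1 := key 1 (by norm_num) (by norm_num)
  have h2 := key 2 (by norm_num) (by norm_num)
  have h3 := key 3 (by norm_num) (by norm_num)
  have h4 := key 4 (by norm_num) (by norm_num)
  have h5 := key 5 (by norm_num) (by norm_num)
  rw [H_eq h1 h2 h3 h4 h5]
  rw [← W_per] at h1 h2 h3 h4 h5
  rw [H_eq h1 h2 h3 h4 h5]
  rw [W_per]
  have hp := E_per x
  have hW : W x ≠ 0 := Complex.exp_ne_zero _
  have hr : W x = ((Real.exp (2 * π / Real.sqrt 3 * x) : ℝ) : ℂ) := by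
    unfold W; push_cast; rfl
  have p := Real.exp_pos (2 * π / Real.sqrt 3 * x)
  have n1 : 1 + W x ^ 3 ≠ 0 := by
    rw [hr]
    have : 1 + (Real.exp (2 * π / Real.sqrt 3 * x)) ^ 3 ≠ 0 := by positivity
    exact_mod_cast this
  have n2 : 1 + W x + W x ^ 2 ≠ 0 := by
    rw [hr]
    have : 1 + Real.exp (2 * π / Real.sqrt 3 * x) + (Real.exp (2 * π / Real.sqrt 3 * x)) ^ 2 ≠ 0 := by positivity
    exact_mod_cast this
  have hE : E (x + Real.sqrt 3 * I) = - E x / W x ^ 3 := by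
    rw [eq_div_iff (pow_ne_zero _ hW), hp]
  rw [hE]
  field_simp
  ring

lemma norm_W (z : ℂ) : ‖W z‖ = Real.exp (2 * π / Real.sqrt 3 * z.re) := by
  unfold W
  rw [Complex.norm_exp, Complex.re_ofReal_mul]

lemma norm_E (z : ℂ) : ‖E z‖ = Real.exp (-(2 * π * z.re * z.im)) := by
  unfold E
  rw [Complex.norm_exp]
  congr 1
  rw [show I * π * z ^ 2 = (π : ℝ) * (I * z ^ 2) by ring, Complex.re_ofReal_mul]
  simp [pow_two]
  ring

lemma lim_side {L : ℂ} {m : Filter ℝ}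
    (h : Tendsto H (comap Complex.re m ⊓ 𝓟 S) (𝓝 L)) :
    Tendsto (fun T : ℝ => ∫ y in (0:ℝ)..Real.sqrt 3, H (T + y * I)) m (𝓝 (Real.sqrt 3 * L)) := by
  have hs := s3pos
  rw [Metric.tendsto_nhds] at h ⊢
  intro ε hε
  have h2 := h (ε / (2 * Real.sqrt 3)) (by positivity)
  rw [eventually_inf_principal, eventually_comap] at h2
  filter_upwards [h2] with T hT
  have hmem : ∀ y ∈ Set.Icc (0:ℝ) (Real.sqrt 3), (T + y * I : ℂ) ∈ S := by
    intro y hy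
    simpa [S] using hy
  have hcont : ContinuousOn (fun y : ℝ => H (T + y * I)) (Set.uIcc 0 (Real.sqrt 3)) := by
    rw [Set.uIcc_of_le hs.le]
    intro y hy
    apply ContinuousAt.continuousWithinAt
    exact ContinuousAt.comp (f := fun y : ℝ => (T + y * I : ℂ)) (H_diff (hmem y hy)).continuousAt
      (by fun_prop)
  have hi := hcont.intervalIntegrable (μ := volume)
  have e : (∫ y in (0:ℝ)..Real.sqrt 3, H (T + y * I)) - Real.sqrt 3 * L =
      ∫ y in (0:ℝ)..Real.sqrt 3, (H (T + y * I) - L) := by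
    rw [intervalIntegral.integral_sub hi (by simp)]
    simp
  rw [dist_eq_norm, e]
  have := intervalIntegral.norm_integral_le_of_norm_le_const (a := (0:ℝ)) (b := Real.sqrt 3)
    (f := fun y : ℝ => H (T + y * I) - L) (C := ε / (2 * Real.sqrt 3)) (by
      intro y hy
      rw [Set.uIoc_of_le hs.le] at hy
      have := hT (T + y * I) (by simp) (hmem y ⟨hy.1.le, hy.2⟩)
      rw [dist_eq_norm] at this
      exact this.le)
  refine this.trans_lt ?_
  rw [sub_zero, abs_of_pos hs]
  field_simp
  norm_num

lemma norm_W_P (k : ℝ) : ‖W (P k)‖ = 1 := by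
  rw [W_P, Complex.norm_exp_ofReal_mul_I]

lemma cpos : 0 < 2 * π / Real.sqrt 3 := by have := s3pos; positivity

lemma H_right : Tendsto H (comap Complex.re atTop ⊓ 𝓟 S) (𝓝 0) := by
  have hre : Tendsto Complex.re (comap Complex.re atTop ⊓ 𝓟 S) atTop :=
    tendsto_comap.mono_left inf_le_left
  have hpos := hre.eventually (eventually_gt_atTop 0)
  have hS : ∀ᶠ z in comap Complex.re atTop ⊓ 𝓟 S, z ∈ S :=
    eventually_inf_principal.2 (Eventually.of_forall fun _ h => h)
  have hW : Tendsto W (comap Complex.re atTop ⊓ 𝓟 S) (Bornology.cobounded ℂ) := by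
    rw [← tendsto_norm_atTop_iff_cobounded]
    simp_rw [norm_W]
    exact Real.tendsto_exp_atTop.comp (hre.const_mul_atTop cpos)
  have hQ : ∀ k : ℝ, Tendsto (Q (P k)) (comap Complex.re atTop ⊓ 𝓟 S) (𝓝 0) := by
    intro k
    have hi : Tendsto (fun z => (W z - W (P k))⁻¹) (comap Complex.re atTop ⊓ 𝓟 S) (𝓝 0) := by
      apply Filter.tendsto_inv₀_cobounded.comp
      have := (tendsto_add_const_cobounded (-W (P k))).comp hW
      exact this.congr fun z => (sub_eq_add_neg _ _).symm
    have hb : IsBoundedUnder (· ≤ ·) (comap Complex.re atTop ⊓ 𝓟 S)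
        (fun z => ‖E z - E (P k)‖) := by
      refine ⟨2, ?_⟩
      rw [eventually_map]
      filter_upwards [hpos, hS] with z h1 h2
      refine (norm_sub_le _ _).trans ?_
      rw [norm_E, E_P, Complex.norm_exp_ofReal_mul_I]
      have : Real.exp (-(2 * π * z.re * z.im)) ≤ 1 := by
        rw [Real.exp_le_one_iff]
        have := h2.1
        have : 0 ≤ 2 * π * z.re * z.im := by positivity
        linarith
      linarith
    refine (hi.zero_mul_isBoundedUnder_le hb).congr' ?_
    filter_upwards [hpos] with z h1
    rw [Q_eq, div_eq_mul_inv, mul_comm]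
    intro h
    have := congrArg norm h
    rw [norm_W_P, norm_W, Real.exp_eq_one_iff] at this
    exact (mul_pos cpos h1).ne' this
  unfold H
  simpa using ((((hQ 1).const_mul (w / 6)).add ((hQ 2).const_mul ((1 + w) / 6))).add
    ((hQ 3).const_mul (2 / 6))).add ((hQ 4).const_mul ((2 - w) / 6)) |>.add
    ((hQ 5).const_mul ((1 - w) / 6))

noncomputable def L : ℂ := -(w / 6 * E (P 1) / (0 - w) + (1 + w) / 6 * E (P 2) / (0 - (w - 1))
        + 2 / 6 * E (P 3) / (0 - (-1)) + (2 - w) / 6 * E (P 4) / (0 - (-w))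
        + (1 - w) / 6 * E (P 5) / (0 - (1 - w)))

lemma w_ne : w ≠ 0 := by
  rw [← W_P1]; exact Complex.exp_ne_zero _
lemma w_ne1 : w - 1 ≠ 0 := by
  rw [← W_P2]; exact Complex.exp_ne_zero _

lemma H_left : Tendsto H (comap Complex.re atBot ⊓ 𝓟 S) (𝓝 L) := by
  have hre : Tendsto Complex.re (comap Complex.re atBot ⊓ 𝓟 S) atBot :=
    tendsto_comap.mono_left inf_le_left
  have hneg := hre.eventually (eventually_lt_atBot 0)
  have hS : ∀ᶠ z in comap Complex.re atBot ⊓ 𝓟 S, z ∈ S :=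
    eventually_inf_principal.2 (Eventually.of_forall fun _ h => h)
  have hW : Tendsto W (comap Complex.re atBot ⊓ 𝓟 S) (𝓝 0) := by
    rw [tendsto_zero_iff_norm_tendsto_zero]
    simp_rw [norm_W]
    exact Real.tendsto_exp_atBot.comp (hre.const_mul_atBot cpos)
  have hb : IsBoundedUnder (· ≤ ·) (comap Complex.re atBot ⊓ 𝓟 S)
      (fun z => ‖E z * W z ^ 3‖) := by
    refine ⟨1, ?_⟩
    rw [eventually_map]
    filter_upwards [hneg, hS] with z h1 h2
    rw [norm_mul, norm_pow, norm_E, norm_W, ← Real.exp_nat_mul, ← Real.exp_add, Real.exp_le_one_iff]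
    have h3 := h2.2
    have e : 2 * π / Real.sqrt 3 = 2 * π * Real.sqrt 3 / 3 := by
      have := s3sq
      have := s3pos
      field_simp
      linarith
    rw [e]
    push_cast
    have : 0 ≤ π * ((-z.re) * (Real.sqrt 3 - z.im)) := by
      have := Real.pi_pos
      have h4 : 0 ≤ -z.re := by linarith
      have h5 : 0 ≤ Real.sqrt 3 - z.im := by linarith
      positivity
    linarith
  have hc : Tendsto (fun z => W z / ((1 + W z + W z ^ 2) * (1 + W z ^ 3)))
      (comap Complex.re atBot ⊓ 𝓟 S) (𝓝 0) := by
    have : ContinuousAt (fun u : ℂ => u / ((1 + u + u ^ 2) * (1 + u ^ 3))) 0 := by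
      apply ContinuousAt.div (by fun_prop) (by fun_prop)
      simp
    have h := this.tendsto.comp hW
    simp only [zero_div] at h
    exact h
  have hterm : ∀ a b : ℂ, b ≠ 0 → Tendsto (fun z => a / (W z - b))
      (comap Complex.re atBot ⊓ 𝓟 S) (𝓝 (a / (0 - b))) := by
    intro a b h
    exact tendsto_const_nhds.div (hW.sub_const b) (by simpa using h)
  have hmain := hc.zero_mul_isBoundedUnder_le hb |>.sub
    (((((hterm (w / 6 * E (P 1)) w w_ne).add (hterm ((1 + w) / 6 * E (P 2)) (w - 1) w_ne1)).add
    (hterm (2 / 6 * E (P 3)) (-1) (by simp))).add (hterm ((2 - w) / 6 * E (P 4)) (-w) (by simpa using w_ne))).add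
    (hterm ((1 - w) / 6 * E (P 5)) (1 - w) (by
      have := w_ne1
      intro h; apply this; linear_combination -h)))
  rw [zero_sub] at hmain
  refine Tendsto.congr' ?_ hmain
  filter_upwards [hneg] with z h1
  have key : ∀ k : ℝ, W z ≠ W (P k) := by
    intro k h
    have := congrArg norm h
    rw [norm_W_P, norm_W, Real.exp_eq_one_iff] at this
    exact (mul_neg_of_pos_of_neg cpos h1).ne this
  rw [H_eq (key 1) (key 2) (key 3) (key 4) (key 5)]
  ring

lemma rect (T : ℝ) :
    ∫ x in (-T)..T, E x * (W x / (1 + W x + W x ^ 2)) =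
      I * ((∫ y in (0:ℝ)..Real.sqrt 3, H ((-T : ℝ) + y * I)) - ∫ y in (0:ℝ)..Real.sqrt 3, H (T + y * I)) := by
  have hs := s3pos
  have h := Complex.integral_boundary_rect_eq_zero_of_differentiableOn H ((-T : ℝ) : ℂ) (T + Real.sqrt 3 * I)
    (by
      intro z hz
      apply (H_diff _).differentiableWithinAt
      have := hz.2
      simpa [hs.le, S] using this)
  simp at h
  simp_rw [← H_edge]
  rw [intervalIntegral.integral_sub]
  · push_cast
    linear_combination h
  · apply Continuous.intervalIntegrable
    rw [continuous_iff_continuousAt]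
    intro x
    exact ContinuousAt.comp (f := fun x : ℝ => (x : ℂ)) (H_diff (by simp [S])).continuousAt
      (by fun_prop)
  · apply Continuous.intervalIntegrable
    rw [continuous_iff_continuousAt]
    intro x
    exact ContinuousAt.comp (f := fun x : ℝ => (x + Real.sqrt 3 * I : ℂ)) (H_diff (by simp [S])).continuousAt
      (by fun_prop)

lemma lim_full : Tendsto (fun T : ℝ => ∫ x in (-T)..T, E x * (W x / (1 + W x + W x ^ 2))) atTop
    (𝓝 (I * (Real.sqrt 3 * L))) := by
  have h1 := (lim_side H_left).comp tendsto_neg_atTop_atBot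
  have h2 := lim_side H_right
  have h := (h1.sub h2).const_mul I
  rw [mul_zero, sub_zero] at h
  refine h.congr' ?_
  filter_upwards [eventually_gt_atTop 0] with T hT
  rw [rect T]
  rfl

lemma E5 : E (P 5) = E (P 1) := by
  rw [E_P, E_P, Complex.exp_eq_exp_iff_exists_int]
  refine ⟨-1, ?_⟩
  push_cast; ring

lemma L_eq : L = E (P 1) / 3 + (1 - 2 * w) / 6 * (E (P 2) - E (P 4)) - E (P 3) / 3 := by
  have hw := w_sq
  have i1 : w⁻¹ = 1 - w := inv_eq_of_mul_eq_one_right (by linear_combination -hw)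
  have i2 : (w - 1)⁻¹ = -w := inv_eq_of_mul_eq_one_right (by linear_combination -hw)
  have i3 : (1 - w)⁻¹ = w := inv_eq_of_mul_eq_one_right (by linear_combination -hw)
  unfold L
  simp only [zero_sub, neg_neg, div_neg, div_one]
  rw [div_eq_mul_inv _ w, div_eq_mul_inv _ (w - 1), div_eq_mul_inv _ (1 - w), i1, i2, i3, E5]
  linear_combination (-E (P 1) / 3 - E (P 2) / 6 - E (P 4) / 6) * hw + (w / 6 - 1 / 3) * E (P 4) * i1

lemma E1_im : (E (P 1)).im = -(Real.sqrt 6 - Real.sqrt 2) / 4 := by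
  have e6 : Real.sqrt 6 = Real.sqrt 3 * Real.sqrt 2 := by
    rw [← Real.sqrt_mul (by norm_num)]; norm_num
  rw [E_P, Complex.exp_ofReal_mul_I_im, Real.sin_neg,
    show (1:ℝ) ^ 2 * (π / 12) = π / 3 - π / 4 by ring, Real.sin_sub, Real.cos_pi_div_three,
    Real.sin_pi_div_three, Real.cos_pi_div_four, Real.sin_pi_div_four, e6]
  ring

lemma E3_im : (E (P 3)).im = -Real.sqrt 2 / 2 := by
  rw [E_P, Complex.exp_ofReal_mul_I_im, Real.sin_neg,
    show (3:ℝ) ^ 2 * (π / 12) = π - π / 4 by ring, Real.sin_pi_sub, Real.sin_pi_div_four]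
  ring

lemma E2_re : (E (P 2)).re = 1 / 2 := by
  rw [E_P, Complex.exp_ofReal_mul_I_re, Real.cos_neg,
    show (2:ℝ) ^ 2 * (π / 12) = π / 3 by ring, Real.cos_pi_div_three]

lemma E4_re : (E (P 4)).re = -1 / 2 := by
  rw [E_P, Complex.exp_ofReal_mul_I_re, Real.cos_neg,
    show (4:ℝ) ^ 2 * (π / 12) = π / 3 + π by ring, Real.cos_add_pi, Real.cos_pi_div_three]
  ring

lemma L_im : L.im = (E (P 1)).im / 3 - Real.sqrt 3 / 6 * ((E (P 2)).re - (E (P 4)).re)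
    - (E (P 3)).im / 3 := by
  have : L = ((1 / 3 : ℝ) : ℂ) * E (P 1) + ((-(Real.sqrt 3 / 6) : ℝ) : ℂ) * (I * (E (P 2) - E (P 4)))
      - ((1 / 3 : ℝ) : ℂ) * E (P 3) := by
    rw [L_eq]; unfold w; push_cast; ring
  rw [this, Complex.sub_im, Complex.add_im, Complex.im_ofReal_mul, Complex.im_ofReal_mul,
    Complex.im_ofReal_mul, Complex.I_mul_im, Complex.sub_re]
  ring

lemma L_val : (I * (Real.sqrt 3 * L)).re = (2 - Real.sqrt 6 + Real.sqrt 2) / 4 := by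
  have e6 : Real.sqrt 6 = Real.sqrt 3 * Real.sqrt 2 := by
    rw [← Real.sqrt_mul (by norm_num)]; norm_num
  have h3 := s3sq
  rw [Complex.I_mul_re, Complex.im_ofReal_mul, L_im, E1_im, E3_im, E2_re, E4_re, e6]
  linear_combination (Real.sqrt 2 / 12 + 1 / 6) * h3

noncomputable def g (x : ℝ) : ℝ := Real.cos (π * x ^ 2) / (1 + 2 * Real.cosh (2 * π * x / Real.sqrt 3))

lemma g_cont : Continuous g := by
  unfold g
  apply Continuous.div (by fun_prop) (by fun_prop)
  intro x
  have := Real.cosh_pos (2 * π * x / Real.sqrt 3)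
  positivity

lemma f_re (x : ℝ) : (E x * (W x / (1 + W x + W x ^ 2))).re = g x := by
  have hr : W x = ((Real.exp (2 * π * x / Real.sqrt 3) : ℝ) : ℂ) := by
    unfold W; push_cast; congr 1; ring
  have hE : E x = cexp ((π * x ^ 2 : ℝ) * I) := by
    unfold E; push_cast; congr 1; ring
  rw [hr, hE]
  unfold g
  rw [Real.cosh_eq, Real.exp_neg]
  set u := Real.exp (2 * π * x / Real.sqrt 3)
  have hu : 0 < u := Real.exp_pos _
  have : ((u : ℂ) / (1 + u + u ^ 2)) = ((u / (1 + u + u ^ 2) : ℝ) : ℂ) := by push_cast; rfl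
  rw [this, Complex.re_mul_ofReal, Complex.exp_ofReal_mul_I_re]
  field_simp
  ring

lemma g_int : IntegrableOn g (Set.Ioi 0) := by
  have h := integrableOn_exp_mul_Ioi (a := -(2 * π / Real.sqrt 3)) (by linarith [cpos]) 0
  refine Integrable.mono' h g_cont.aestronglyMeasurable ?_
  refine Eventually.of_forall fun x => ?_
  unfold g
  rw [norm_div, Real.norm_eq_abs, Real.norm_eq_abs]
  have hp : 0 < 1 + 2 * Real.cosh (2 * π * x / Real.sqrt 3) := by
    have := Real.cosh_pos (2 * π * x / Real.sqrt 3)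
    positivity
  rw [abs_of_pos hp, div_le_iff₀ hp]
  refine (Real.abs_cos_le_one _).trans ?_
  rw [Real.cosh_eq, show -(2 * π / Real.sqrt 3) * x = -(2 * π * x / Real.sqrt 3) by ring]
  have e : Real.exp (-(2 * π * x / Real.sqrt 3)) * Real.exp (2 * π * x / Real.sqrt 3) = 1 := by
    rw [← Real.exp_add]; simp
  have := Real.exp_pos (-(2 * π * x / Real.sqrt 3))
  nlinarith

lemma g_even (T : ℝ) : ∫ x in (-T)..T, g x = 2 * ∫ x in (0:ℝ)..T, g x := by
  rw [← intervalIntegral.integral_add_adjacent_intervals (b := 0)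
    (g_cont.intervalIntegrable _ _) (g_cont.intervalIntegrable _ _)]
  have h := intervalIntegral.integral_comp_neg (a := 0) (b := T) g
  have e : ∀ x, g (-x) = g x := by
    intro x; unfold g
    rw [show 2 * π * -x / Real.sqrt 3 = -(2 * π * x / Real.sqrt 3) by ring, Real.cosh_neg, neg_sq]
  simp_rw [e] at h
  rw [neg_zero] at h
  linarith

lemma final : ∫ x in Set.Ioi (0:ℝ), g x = (2 - Real.sqrt 6 + Real.sqrt 2) / 8 := by
  have h1 := intervalIntegral_tendsto_integral_Ioi 0 g_int tendsto_id
  have h2 := (Complex.continuous_re.tendsto _).comp lim_full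
  rw [L_val] at h2
  have h3 : Tendsto (fun T : ℝ => 2 * ∫ x in (0:ℝ)..T, g x) atTop
      (𝓝 ((2 - Real.sqrt 6 + Real.sqrt 2) / 4)) := by
    refine h2.congr fun T => ?_
    rw [← g_even]
    simp_rw [← f_re]
    have hi : IntervalIntegrable (fun x : ℝ => E x * (W x / (1 + W x + W x ^ 2))) volume (-T) T := by
      apply Continuous.intervalIntegrable
      have c1 : Continuous fun x : ℝ => E x := E_diff.continuous.comp Complex.continuous_ofReal
      have c2 : Continuous fun x : ℝ => W x := W_diff.continuous.comp Complex.continuous_ofReal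
      refine c1.mul (c2.div (by fun_prop) ?_)
      intro x
      have hr : W x = ((Real.exp (2 * π / Real.sqrt 3 * x) : ℝ) : ℂ) := by
        unfold W; push_cast; rfl
      rw [hr]
      have : 1 + Real.exp (2 * π / Real.sqrt 3 * x) + (Real.exp (2 * π / Real.sqrt 3 * x)) ^ 2 ≠ 0 := by positivity
      exact_mod_cast this
    exact (Complex.reCLM.intervalIntegral_comp_comm hi).symm
  have := tendsto_nhds_unique (h1.const_mul 2) h3
  linarith

end Mordell

theorem stmt9 :
    ∫ x in Set.Ioi (0:ℝ), Real.cos (π * x ^ 2) / (1 + 2 * Real.cosh (2 * π * x / Real.sqrt 3)) = (2 - Real.sqrt 6 + Real.sqrt 2) / 8 := Mordell.final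
end

section
/- ∫₀^∞ cos(π x)/(exp(2π√x) − 1) dx = (2 − √2)/8. -/
open Real MeasureTheory

noncomputable def MM (z : ℂ) : ℂ := Complex.exp (2 * π * z) - 1

lemma MM_hasDeriv (z : ℂ) : HasDerivAt MM (Complex.exp (2 * π * z) * (2 * π)) z := by
  unfold MM
  have := (((hasDerivAt_id z).const_mul (2 * π : ℂ)).cexp).sub_const 1
  simpa using this

lemma MM_zero {z : ℂ} (h : MM z = 0) : z.re = 0 ∧ ∃ n : ℤ, z.im = n := by
  unfold MM at h
  rw [sub_eq_zero, Complex.exp_eq_one_iff] at h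
  obtain ⟨n, hn⟩ := h
  have hpi : (π : ℂ) ≠ 0 := by exact_mod_cast Real.pi_ne_zero
  have : z = n * Complex.I := by
    have : (2 * π : ℂ) * z = (2 * π) * (n * Complex.I) := by rw [hn]; ring
    exact mul_left_cancel₀ (by simp [hpi]) this
  subst this
  simp

open Classical in
noncomputable def GG (N : ℂ → ℂ) (z : ℂ) : ℂ :=
  if MM z = 0 then deriv N z / deriv MM z else N z / MM z

lemma GG_cont {N : ℂ → ℂ} (hN : Differentiable ℂ N) {z : ℂ} (h : MM z = 0 → N z = 0) :
    ContinuousAt (GG N) z := by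
  have hMc : Continuous MM := by unfold MM; fun_prop
  by_cases hz : MM z = 0
  · have hNz := h hz
    have hd := MM_hasDeriv z
    have hd0 : Complex.exp (2 * π * z) * (2 * π) ≠ 0 := by
      have hpi : (π : ℂ) ≠ 0 := by exact_mod_cast Real.pi_ne_zero
      simp [hpi, Complex.exp_ne_zero]
    have h1 := (hN z).hasDerivAt.tendsto_slope
    have h2 := hd.tendsto_slope
    rw [← continuousWithinAt_compl_self]
    unfold ContinuousWithinAt
    have e1 : GG N z = deriv N z / (Complex.exp (2 * π * z) * (2 * π)) := by
      simp only [GG, hz, if_true, hd.deriv]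
    rw [e1]
    refine (h1.div h2 hd0).congr' ?_
    have hne : ∀ᶠ w in nhdsWithin z {z}ᶜ, MM w ≠ 0 := by
      have := hd.eventually_ne (c := 0) hd0
      exact this
    filter_upwards [hne, self_mem_nhdsWithin] with w hw hwz
    have hwz' : w - z ≠ 0 := sub_ne_zero.mpr hwz
    simp only [Pi.div_apply, GG, hw, if_false, slope_def_field, hz, hNz, sub_zero]
    field_simp
  · have : (fun w => N w / MM w) =ᶠ[nhds z] GG N := by
      filter_upwards [hMc.continuousAt.eventually_ne hz] with w hw
      simp [GG, hw]
    exact ((hN.continuous.continuousAt).div hMc.continuousAt hz).congr this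

lemma GG_diff {N : ℂ → ℂ} (hN : Differentiable ℂ N) {z : ℂ} (hz : MM z ≠ 0) :
    DifferentiableAt ℂ (GG N) z := by
  have hMc : Continuous MM := by unfold MM; fun_prop
  have : GG N =ᶠ[nhds z] (fun w => N w / MM w) := by
    filter_upwards [hMc.continuousAt.eventually_ne hz] with w hw
    simp [GG, hw]
  exact ((hN z).div (MM_hasDeriv z).differentiableAt hz).congr_of_eventuallyEq this

lemma MM_lower {z : ℂ} (h : 1 ≤ z.re) : Real.exp (2 * z.re) ≤ ‖MM z‖ := by
  have h1 : ‖Complex.exp (2 * π * z)‖ = Real.exp (2 * π * z.re) := by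
    rw [Complex.norm_exp]; congr 1; simp
  have h2 : ‖Complex.exp (2 * π * z)‖ - ‖(1:ℂ)‖ ≤ ‖MM z‖ := norm_sub_norm_le _ _
  rw [h1, norm_one] at h2
  have h3 : Real.exp (2 * z.re + 1) ≤ Real.exp (2 * π * z.re) := by
    apply Real.exp_le_exp.mpr
    nlinarith [Real.pi_gt_three]
  rw [Real.exp_add] at h3
  have h4 := Real.add_one_le_exp (1:ℝ)
  have h5 : 1 ≤ Real.exp (2 * z.re) := Real.one_le_exp (by linarith)
  nlinarith

/-- half-strip Cauchy -/
lemma strip {g : ℂ → ℂ} {a b C : ℝ} (hab : a ≤ b)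
    (hc : ContinuousOn g (Set.Ici 0 ×ℂ Set.Icc a b))
    (hd : DifferentiableOn ℂ g (Set.Ioi 0 ×ℂ Set.Ioo a b))
    (hb : ∀ x y : ℝ, 1 ≤ x → a ≤ y → y ≤ b → ‖g (x + y * Complex.I)‖ ≤ C * Real.exp (-x)) :
    (∀ y, a ≤ y → y ≤ b → IntegrableOn (fun t : ℝ => g (t + y * Complex.I)) (Set.Ioi 0)) ∧
    (∫ t in Set.Ioi (0:ℝ), g (t + a * Complex.I)) - (∫ t in Set.Ioi (0:ℝ), g (t + b * Complex.I))
      = Complex.I * ∫ y in a..b, g (y * Complex.I) := by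
  have hint : ∀ y, a ≤ y → y ≤ b →
      IntegrableOn (fun t : ℝ => g (t + y * Complex.I)) (Set.Ioi 0) := by
    intro y hy1 hy2
    have hcy : ContinuousOn (fun t : ℝ => g (t + y * Complex.I)) (Set.Ici 0) := by
      refine hc.comp (by fun_prop) ?_
      intro t ht
      simp only [Complex.mem_reProdIm]
      simpa using ⟨ht, hy1, hy2⟩
    have : Set.Ioi (0:ℝ) = Set.Ioc 0 1 ∪ Set.Ioi 1 := by
      rw [Set.Ioc_union_Ioi_eq_Ioi]; norm_num
    rw [this]
    refine IntegrableOn.union ?_ ?_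
    · refine IntegrableOn.mono_set (ContinuousOn.integrableOn_Icc (hcy.mono ?_)) Set.Ioc_subset_Icc_self
      exact Set.Icc_subset_Ici_self
    · have h1 : IntegrableOn (fun t : ℝ => C * Real.exp (-t)) (Set.Ioi 1) :=
        (integrableOn_exp_neg_Ioi 1).const_mul C
      refine Integrable.mono' h1 ?_ ?_
      · refine ContinuousOn.aestronglyMeasurable (hcy.mono ?_) measurableSet_Ioi
        intro t ht
        have : (1:ℝ) < t := ht
        simp only [Set.mem_Ici]; linarith
      · refine (ae_restrict_iff' measurableSet_Ioi).mpr (Filter.Eventually.of_forall ?_)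
        intro t ht
        exact hb t y (le_of_lt ht) hy1 hy2
  refine ⟨hint, ?_⟩
  have hT : ∀ T : ℝ, 0 < T → (∫ t in (0:ℝ)..T, g (t + a * Complex.I)) -
      (∫ t in (0:ℝ)..T, g (t + b * Complex.I)) + Complex.I * (∫ y in a..b, g (T + y * Complex.I))
      - Complex.I * ∫ y in a..b, g (y * Complex.I) = 0 := by
    intro T hT
    have := Complex.integral_boundary_rect_eq_zero_of_continuousOn_of_differentiableOn g
      (a * Complex.I) (T + b * Complex.I) (hc.mono ?_) (hd.mono ?_)
    · simpa using this
    · intro z hz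
      simp only [Complex.mem_reProdIm] at hz ⊢
      simp [Set.uIcc_of_le hT.le, Set.uIcc_of_le hab] at hz
      simp; tauto
    · intro z hz
      simp only [Complex.mem_reProdIm] at hz ⊢
      simp [min_eq_left hT.le, min_eq_left hab, max_eq_right hT.le, max_eq_right hab] at hz
      simp; tauto
  have l1 := intervalIntegral_tendsto_integral_Ioi 0 (hint a le_rfl hab) Filter.tendsto_id
  have l2 := intervalIntegral_tendsto_integral_Ioi 0 (hint b hab le_rfl) Filter.tendsto_id
  have l3 : Filter.Tendsto (fun T : ℝ => ∫ y in a..b, g (T + y * Complex.I)) Filter.atTop (nhds 0) := by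
    have h0 : Filter.Tendsto (fun T : ℝ => C * Real.exp (-T) * |b - a|) Filter.atTop (nhds 0) := by
      have := ((Real.tendsto_exp_neg_atTop_nhds_zero).const_mul C).mul_const |b - a|
      simpa using this
    refine squeeze_zero_norm' ?_ h0
    filter_upwards [Filter.eventually_ge_atTop 1] with T hT
    apply intervalIntegral.norm_integral_le_of_norm_le_const
    intro y hy
    rw [Set.uIoc_of_le hab] at hy
    exact hb T y hT hy.1.le hy.2
  have l4 := ((l1.sub l2).add (l3.const_mul Complex.I)).sub_const (Complex.I * ∫ y in a..b, g (y * Complex.I))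
  have l5 := tendsto_nhds_unique (l4.congr' (f₂ := fun _ => 0) ?_) tendsto_const_nhds
  · rw [mul_zero, add_zero, sub_eq_zero] at l5
    exact l5
  · filter_upwards [Filter.eventually_gt_atTop 0] with T h
    exact hT T h

lemma strip2 {N : ℂ → ℂ} {a b : ℝ} (hab : a ≤ b) (hN : Differentiable ℂ N)
    (hz : ∀ z : ℂ, a ≤ z.im → z.im ≤ b → MM z = 0 → N z = 0)
    (hi : ∀ n : ℤ, ¬ (a < (n:ℝ) ∧ (n:ℝ) < b))
    (hb : ∀ z : ℂ, 1 ≤ z.re → a ≤ z.im → z.im ≤ b → ‖N z‖ ≤ 3 * Real.exp z.re) :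
    (∀ y, a ≤ y → y ≤ b → IntegrableOn (fun t : ℝ => N (t + y * Complex.I) / MM (t + y * Complex.I)) (Set.Ioi 0)) ∧
    IntervalIntegrable (fun y : ℝ => N (y * Complex.I) / MM (y * Complex.I)) volume a b ∧
    (∫ t in Set.Ioi (0:ℝ), N (t + a * Complex.I) / MM (t + a * Complex.I)) - (∫ t in Set.Ioi (0:ℝ), N (t + b * Complex.I) / MM (t + b * Complex.I))
      = Complex.I * ∫ y in a..b, N (y * Complex.I) / MM (y * Complex.I) := by
  have key := strip (g := GG N) (a := a) (b := b) (C := 3) hab ?_ ?_ ?_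
  · have e1 : ∀ y : ℝ, Set.EqOn (fun t : ℝ => GG N (t + y * Complex.I))
        (fun t : ℝ => N (t + y * Complex.I) / MM (t + y * Complex.I)) (Set.Ioi 0) := by
      intro y t ht
      have : MM (t + y * Complex.I) ≠ 0 := by
        intro h
        have := (MM_zero h).1
        simp at this
        exact absurd this (ne_of_gt ht)
      simp [GG, this]
    have e2 : ∀ y ∈ Set.Ioo a b, GG N (y * Complex.I) = N (y * Complex.I) / MM (y * Complex.I) := by
      intro y hy
      have : MM (y * Complex.I) ≠ 0 := by
        intro h
        obtain ⟨n, hn⟩ := (MM_zero h).2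
        simp at hn
        exact hi n (by rw [← hn]; exact hy)
      simp [GG, this]
    have e3 : ∀ᵐ y : ℝ, y ∈ Set.uIoc a b → GG N (y * Complex.I) = N (y * Complex.I) / MM (y * Complex.I) := by
      have : ∀ᵐ y : ℝ, y ≠ b := by
        simp [ae_iff]
      filter_upwards [this] with y hyb hy
      rw [Set.uIoc_of_le hab] at hy
      exact e2 y ⟨hy.1, lt_of_le_of_ne hy.2 hyb⟩
    obtain ⟨k1, k2⟩ := key
    refine ⟨fun y h1 h2 => (k1 y h1 h2).congr_fun (e1 y) measurableSet_Ioi, ?_, ?_⟩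
    · have : IntervalIntegrable (fun y : ℝ => GG N (y * Complex.I)) volume a b := by
        apply ContinuousOn.intervalIntegrable
        intro y hy
        rw [Set.uIcc_of_le hab] at hy
        apply ContinuousAt.continuousWithinAt
        refine ContinuousAt.comp (f := fun y : ℝ => (y * Complex.I : ℂ)) (g := GG N) ?_ (by fun_prop)
        apply GG_cont hN
        intro h
        exact hz _ (by simpa using hy.1) (by simpa using hy.2) h
      refine this.congr_ae ?_
      rw [Filter.EventuallyEq, ae_restrict_iff' measurableSet_uIoc]
      exact e3
    · rw [setIntegral_congr_fun measurableSet_Ioi (e1 a), setIntegral_congr_fun measurableSet_Ioi (e1 b),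
        intervalIntegral.integral_congr_ae e3] at k2
      exact k2
  · intro z h
    simp only [Complex.mem_reProdIm, Set.mem_Icc] at h
    exact (GG_cont hN (hz z h.2.1 h.2.2)).continuousWithinAt
  · intro z h
    simp only [Complex.mem_reProdIm, Set.mem_Ioi] at h
    refine (GG_diff hN ?_).differentiableWithinAt
    intro h0
    exact absurd (MM_zero h0).1 (ne_of_gt h.1)
  · intro x y hx hy1 hy2
    have hM := MM_lower (z := x + y * Complex.I) (by simpa using hx)
    have hN' := hb (x + y * Complex.I) (by simpa using hx) (by simpa using hy1) (by simpa using hy2)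
    simp at hM hN'
    have hM0 : MM (x + y * Complex.I) ≠ 0 := by
      intro h
      rw [h, norm_zero] at hM
      exact absurd (Real.exp_pos (2 * x)) (not_lt.mpr hM)
    simp only [GG, hM0, if_false, norm_div]
    rw [div_le_iff₀ (norm_pos_iff.mpr hM0)]
    refine hN'.trans ?_
    have : Real.exp x = Real.exp (-x) * Real.exp (2 * x) := by rw [← Real.exp_add]; congr 1; ring
    rw [this, ← mul_assoc]
    exact mul_le_mul_of_nonneg_left hM (by positivity)

lemma quad_int {b : ℂ} (hb : 0 < b.re) (c : ℂ) :
    Integrable (fun t : ℝ => Complex.exp (-b * t ^ 2 + c * t)) := by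
  have := integrable_cexp_quadratic hb c 0
  simpa using this

lemma quad_int2 {b : ℂ} (hb : 0 < b.re) (c : ℂ) :
    IntegrableOn (fun t : ℝ => (t:ℂ) * Complex.exp (-b * t ^ 2 + c * t)) (Set.Ioi 0) := by
  have := (quad_int hb (c + 1)).norm.integrableOn (s := Set.Ioi 0)
  refine Integrable.mono' this (by fun_prop) ?_
  refine (ae_restrict_iff' measurableSet_Ioi).mpr (Filter.Eventually.of_forall ?_)
  intro t ht
  have ht : (0:ℝ) < t := ht
  have : -b * t ^ 2 + (c + 1) * t = (-b * t ^ 2 + c * t) + t := by ring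
  rw [this, Complex.exp_add (-b * t ^ 2 + c * t), norm_mul, norm_mul, mul_comm ‖(t:ℂ)‖]
  refine mul_le_mul_of_nonneg_left ?_ (norm_nonneg _)
  rw [Complex.norm_exp, Complex.norm_real, Real.norm_of_nonneg ht.le, Complex.ofReal_re]
  linarith [Real.add_one_le_exp t]

noncomputable def HH (b : ℂ) (a : ℝ) : ℂ :=
  ∫ t in Set.Ioi (0:ℝ), Complex.exp (-b * t ^ 2 + (-(2 * π * a) : ℂ) * t)

lemma HH_parts {b : ℂ} (hb : 0 < b.re) (a : ℝ) :
    ∫ t in Set.Ioi (0:ℝ), (t:ℂ) * Complex.exp (-b * t ^ 2 + (-(2 * π * a) : ℂ) * t)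
      = (1 - 2 * π * a * HH b a) / (2 * b) := by
  have hb0 : b ≠ 0 := by rintro rfl; simp at hb
  have h1 := quad_int2 hb (-(2 * π * a) : ℂ)
  have h2 := (quad_int hb (-(2 * π * a) : ℂ)).integrableOn (s := Set.Ioi 0)
  have hder : ∀ t ∈ Set.Ici (0:ℝ), HasDerivAt (fun t : ℝ => Complex.exp (-b * t ^ 2 + (-(2 * π * a) : ℂ) * t))
      ((-2 * b) * ((t:ℂ) * Complex.exp (-b * t ^ 2 + (-(2 * π * a) : ℂ) * t)) +
       (-(2 * π * a)) * Complex.exp (-b * t ^ 2 + (-(2 * π * a) : ℂ) * t)) t := by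
    intro t _
    have h0 : HasDerivAt (fun t : ℝ => (t : ℂ)) 1 t := Complex.ofRealCLM.hasDerivAt
    have := (((h0.pow 2).const_mul (-b)).add (h0.const_mul (-(2 * π * a) : ℂ))).cexp
    refine this.congr_deriv ?_
    simp
    ring
  have hint := (h1.const_mul (-2 * b)).add (h2.const_mul (-(2 * π * a) : ℂ))
  have ht := tendsto_zero_of_hasDerivAt_of_integrableOn_Ioi (a := 0) (fun t ht => hder t (Set.mem_Ici.mpr (le_of_lt ht))) hint h2
  have := integral_Ioi_of_hasDerivAt_of_tendsto' hder hint ht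
  rw [integral_add (h1.const_mul _) (h2.const_mul _), integral_const_mul, integral_const_mul] at this
  simp at this
  unfold HH
  rw [eq_div_iff (by simpa using hb0)]
  simp
  linear_combination -this

lemma HH_deriv {b : ℂ} (hb : 0 < b.re) (a : ℝ) :
    HasDerivAt (HH b) (-(π / b) * (1 - 2 * π * a * HH b a)) a := by
  have hb0 : b ≠ 0 := by rintro rfl; simp at hb
  have key := hasDerivAt_integral_of_dominated_loc_of_deriv_le (μ := volume.restrict (Set.Ioi (0:ℝ)))
    (F := fun (a : ℝ) (t : ℝ) => Complex.exp (-b * t ^ 2 + (-(2 * π * a) : ℂ) * t))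
    (F' := fun (a : ℝ) (t : ℝ) => (-(2 * π)) * ((t:ℂ) * Complex.exp (-b * t ^ 2 + (-(2 * π * a) : ℂ) * t)))
    (x₀ := a) (s := Metric.ball a 1)
    (bound := fun t => 2 * π * ‖(t:ℂ) * Complex.exp (-b * t ^ 2 + ((2 * π * (|a| + 1) : ℝ) : ℂ) * t)‖)
    (Metric.ball_mem_nhds a one_pos) ?_ ?_ ?_ ?_ ?_ ?_
  · have := key.2
    rw [integral_const_mul, HH_parts hb] at this
    refine this.congr_deriv ?_
    field_simp
  · exact Filter.Eventually.of_forall fun x => (quad_int hb _).integrableOn.aestronglyMeasurable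
  · exact (quad_int hb _).integrableOn
  · exact ((quad_int2 hb _).const_mul _).aestronglyMeasurable
  · refine (ae_restrict_iff' measurableSet_Ioi).mpr (Filter.Eventually.of_forall ?_)
    intro t ht x hx
    have ht : (0:ℝ) < t := ht
    rw [norm_mul, norm_mul, norm_mul]
    have : ‖(-(2 * π) : ℂ)‖ = 2 * π := by
      simp [abs_of_pos Real.pi_pos]
    rw [this]
    gcongr
    rw [Complex.norm_exp, Complex.norm_exp]
    apply Real.exp_le_exp.mpr
    rw [Complex.add_re, Complex.add_re]
    refine add_le_add le_rfl ?_
    have e : (-(2 * π * x) * t : ℂ) = ((-(2 * π * x) * t : ℝ) : ℂ) := by push_cast; ring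
    rw [e, ← Complex.ofReal_mul, Complex.ofReal_re, Complex.ofReal_re]
    gcongr
    rw [Metric.mem_ball, Real.dist_eq] at hx
    have : -x ≤ |a| + 1 := by
      have := abs_lt.mp hx
      have := neg_abs_le a
      linarith
    nlinarith [Real.pi_pos]
  · exact ((quad_int2 hb _).norm).const_mul _
  · refine Filter.Eventually.of_forall ?_
    intro t x _
    have h0 : HasDerivAt (fun t : ℝ => (t : ℂ)) 1 x := Complex.ofRealCLM.hasDerivAt
    have := (((h0.const_mul (2 * π : ℂ)).neg.mul_const (t:ℂ)).const_add (-b * t ^ 2)).cexp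
    refine this.congr_deriv ?_
    simp
    ring

lemma HH_formula {b : ℂ} (hb : 0 < b.re) (a : ℝ) :
    Complex.exp (-(π ^ 2 * a ^ 2) / b) * HH b a
      = (π / b) ^ (1 / 2 : ℂ) / 2 - (π / b) * ∫ s in (0:ℝ)..a, Complex.exp (-(π ^ 2 * s ^ 2) / b) := by
  have hb0 : b ≠ 0 := by rintro rfl; simp at hb
  have hd : ∀ x ∈ Set.uIcc 0 a, HasDerivAt (fun x : ℝ => Complex.exp (-(π ^ 2 * x ^ 2) / b) * HH b x)
      (-(π / b) * Complex.exp (-(π ^ 2 * x ^ 2) / b)) x := by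
    intro x _
    have h0 : HasDerivAt (fun t : ℝ => (t : ℂ)) 1 x := Complex.ofRealCLM.hasDerivAt
    have := ((((h0.pow 2).const_mul (π ^ 2 : ℂ)).neg.div_const b).cexp).mul (HH_deriv hb x)
    refine this.congr_deriv ?_
    simp
    field_simp
    ring
  have := intervalIntegral.integral_eq_sub_of_hasDerivAt hd (Continuous.intervalIntegrable (by fun_prop) _ _)
  rw [intervalIntegral.integral_const_mul] at this
  have h00 : HH b 0 = (π / b) ^ (1 / 2 : ℂ) / 2 := by
    rw [← integral_gaussian_complex_Ioi hb]
    simp [HH]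
  simp only [h00] at this
  simp at this
  simp
  linear_combination -this

lemma H_formula {a : ℝ} (ha : 0 < a) :
    Complex.exp (-(Complex.I * π * a ^ 2)) *
      (∫ t in Set.Ioi (0:ℝ), Complex.exp (Complex.I * π * t ^ 2 + (-(2 * π * a) : ℂ) * t))
      = Complex.I ^ (1 / 2 : ℂ) / 2 - Complex.I * ∫ s in (0:ℝ)..a, Complex.exp (-(Complex.I * π * s ^ 2)) := by
  have hpi : (π : ℂ) ≠ 0 := by exact_mod_cast Real.pi_ne_zero
  set B : ℝ → ℂ := fun ε => (ε : ℂ) - Complex.I * π with hB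
  have hB0 : B 0 = - Complex.I * π := by simp [hB]
  have hBne : B 0 ≠ 0 := by rw [hB0]; simp [hpi]
  have hBt : Filter.Tendsto B (nhdsWithin 0 (Set.Ioi 0)) (nhds (B 0)) := by
    have : Continuous B := by fun_prop
    exact this.continuousAt.tendsto.mono_left nhdsWithin_le_nhds
  have hBre : ∀ ε, (B ε).re = ε := by intro ε; simp [hB]
  have hq : (π : ℂ) / B 0 = Complex.I := by
    rw [hB0]; field_simp; simp
  have hq2 : ∀ s : ℂ, -(π ^ 2 * s ^ 2) / B 0 = -(Complex.I * π * s ^ 2) := by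
    intro s
    have : -(π ^ 2 * s ^ 2) / B 0 = -(π * s ^ 2) * (π / B 0) := by ring
    rw [this, hq]; ring
  have t1 : Filter.Tendsto (fun ε => Complex.exp (-(π ^ 2 * a ^ 2) / B ε)) (nhdsWithin 0 (Set.Ioi 0))
      (nhds (Complex.exp (-(Complex.I * π * a ^ 2)))) := by
    rw [← hq2]
    exact (Complex.continuous_exp.tendsto _).comp (tendsto_const_nhds.div hBt hBne)
  have t2 : Filter.Tendsto (fun ε => HH (B ε) a) (nhdsWithin 0 (Set.Ioi 0))
      (nhds (∫ t in Set.Ioi (0:ℝ), Complex.exp (Complex.I * π * t ^ 2 + (-(2 * π * a) : ℂ) * t))) := by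
    unfold HH
    refine tendsto_integral_filter_of_dominated_convergence (fun t => Real.exp (-(2 * π * a) * t)) ?_ ?_ ?_ ?_
    · exact Filter.Eventually.of_forall fun ε => by fun_prop
    · filter_upwards [self_mem_nhdsWithin] with ε hε
      refine (ae_restrict_iff' measurableSet_Ioi).mpr (Filter.Eventually.of_forall ?_)
      intro t ht
      have hε : (0:ℝ) < ε := hε
      rw [Complex.norm_exp]
      apply Real.exp_le_exp.mpr
      have e : (-B ε * t ^ 2 + -(2 * π * a) * t : ℂ) = ((-ε * t ^ 2 + (-(2 * π * a) * t) : ℝ) : ℂ) + ((π * t ^ 2 : ℝ) : ℂ) * Complex.I := by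
        simp only [hB]; push_cast; ring
      rw [e]
      simp
      have := mul_nonneg hε.le (sq_nonneg t)
      norm_cast
      simpa using this
    · exact integrableOn_exp_mul_Ioi (by nlinarith [Real.pi_pos, mul_pos Real.pi_pos ha]) 0
    · refine Filter.Eventually.of_forall ?_
      intro t
      have e : Complex.I * π = - B 0 := by rw [hB0]; ring
      rw [e]
      exact (Complex.continuous_exp.tendsto _).comp ((hBt.neg.mul_const _).add_const _)
  have t3 : Filter.Tendsto (fun ε => (π / B ε) ^ (1 / 2 : ℂ) / 2) (nhdsWithin 0 (Set.Ioi 0))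
      (nhds (Complex.I ^ (1 / 2 : ℂ) / 2)) := by
    have h1 : Filter.Tendsto (fun ε => π / B ε) (nhdsWithin 0 (Set.Ioi 0)) (nhds Complex.I) := by
      rw [← hq]
      exact tendsto_const_nhds.div hBt hBne
    refine Filter.Tendsto.div_const ?_ 2
    have h2 : ContinuousAt (fun z : ℂ => z ^ (1 / 2 : ℂ)) Complex.I :=
      continuousAt_cpow_const (by simp [Complex.slitPlane])
    exact h2.tendsto.comp h1
  have t4 : Filter.Tendsto (fun ε => ∫ s in (0:ℝ)..a, Complex.exp (-(π ^ 2 * s ^ 2) / B ε)) (nhdsWithin 0 (Set.Ioi 0))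
      (nhds (∫ s in (0:ℝ)..a, Complex.exp (-(Complex.I * π * s ^ 2)))) := by
    refine intervalIntegral.tendsto_integral_filter_of_dominated_convergence (fun t => 1) ?_ ?_ ?_ ?_
    · exact Filter.Eventually.of_forall fun ε => by
        apply Continuous.aestronglyMeasurable; fun_prop
    · filter_upwards [self_mem_nhdsWithin] with ε hε
      refine Filter.Eventually.of_forall ?_
      intro s _
      have hε : (0:ℝ) < ε := hε
      rw [Complex.norm_exp, ← Real.exp_zero]
      apply Real.exp_le_exp.mpr
      have e : (-(π ^ 2 * s ^ 2) / B ε : ℂ) = ((-(π ^ 2 * s ^ 2) : ℝ) : ℂ) * (B ε)⁻¹ := by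
        push_cast; rw [div_eq_mul_inv]
      rw [e, Complex.re_ofReal_mul, Complex.inv_re, hBre]
      have := Complex.normSq_nonneg (B ε)
      have h3 : 0 ≤ ε / Complex.normSq (B ε) := by positivity
      have h4 : 0 ≤ π ^ 2 * s ^ 2 := by positivity
      nlinarith [mul_nonneg h4 h3]
    · simp
    · refine Filter.Eventually.of_forall ?_
      intro s _
      rw [← hq2]
      exact (Complex.continuous_exp.tendsto _).comp (tendsto_const_nhds.div hBt hBne)
  have t5 : Filter.Tendsto (fun ε => π / B ε) (nhdsWithin 0 (Set.Ioi 0)) (nhds Complex.I) := by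
      rw [← hq]
      exact tendsto_const_nhds.div hBt hBne
  refine tendsto_nhds_unique (t1.mul t2) ((t3.sub (t5.mul t4)).congr' ?_)
  filter_upwards [self_mem_nhdsWithin] with ε hε
  rw [HH_formula (by rw [hBre]; exact hε)]
noncomputable def N1 (z : ℂ) : ℂ :=
  (z - Complex.I / 2 * (1 - Complex.exp (-(π * z)))) * Complex.exp (Complex.I * π * z ^ 2)
noncomputable def N2 (z : ℂ) : ℂ :=
  (z + Complex.I / 2 * (1 - Complex.exp (-(π * z)))) * Complex.exp (Complex.I * π * z ^ 2 - 2 * π * z)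

lemma p_bound {z : ℂ} (h : 1 ≤ z.re) (h1 : -1 ≤ z.im) (h2 : z.im ≤ 1) (c : ℂ) (hc : ‖c‖ = 1 / 2) :
    ‖z + c * (1 - Complex.exp (-(π * z)))‖ ≤ 3 * Real.exp z.re := by
  have e1 : ‖Complex.exp (-(π * z))‖ ≤ 1 := by
    rw [Complex.norm_exp, Real.exp_le_one_iff]
    simp
    nlinarith [Real.pi_pos]
  have e2 : ‖1 - Complex.exp (-(π * z))‖ ≤ 2 := by
    refine (norm_sub_le _ _).trans ?_
    rw [norm_one]; linarith
  have e3 : ‖z‖ ≤ z.re + 1 := by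
    refine (Complex.norm_le_abs_re_add_abs_im z).trans ?_
    rw [abs_of_nonneg (by linarith)]
    have := abs_le.mpr ⟨h1, h2⟩
    linarith
  refine (norm_add_le _ _).trans ?_
  rw [norm_mul, hc]
  have := Real.add_one_le_exp z.re
  linarith

lemma strip_N1 :
    (∀ y : ℝ, (0:ℝ) ≤ y → y ≤ (1:ℝ) → IntegrableOn (fun t : ℝ => N1 (t + y * Complex.I) / MM (t + y * Complex.I)) (Set.Ioi 0)) ∧
    IntervalIntegrable (fun y : ℝ => N1 (y * Complex.I) / MM (y * Complex.I)) volume (0:ℝ) (1:ℝ) ∧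
    (∫ t in Set.Ioi (0:ℝ), N1 (t + (0:ℝ) * Complex.I) / MM (t + (0:ℝ) * Complex.I)) - (∫ t in Set.Ioi (0:ℝ), N1 (t + (1:ℝ) * Complex.I) / MM (t + (1:ℝ) * Complex.I))
      = Complex.I * ∫ y in (0:ℝ)..(1:ℝ), N1 (y * Complex.I) / MM (y * Complex.I) := strip2 (N := N1) (a := 0) (b := 1) zero_le_one
  (by unfold N1; fun_prop)
  (by
    intro z h0 h1 hz
    obtain ⟨hr, n, hn⟩ := MM_zero hz
    have hn0 : 0 ≤ n := by rw [hn] at h0; exact_mod_cast h0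
    have hn1 : n ≤ 1 := by rw [hn] at h1; exact_mod_cast h1
    have : n = 0 ∨ n = 1 := by omega
    unfold N1
    rcases this with rfl | rfl
    · have : z = 0 := by apply Complex.ext <;> simp [hr, hn]
      simp [this]
    · have : z = Complex.I := by apply Complex.ext <;> simp [hr, hn]
      rw [this, Complex.exp_neg, Complex.exp_pi_mul_I]
      norm_num)
  (by
    rintro n ⟨h1, h2⟩
    have h1 : 0 < n := by exact_mod_cast h1
    have h2 : n < 1 := by exact_mod_cast h2
    omega)
  (by
    intro z h h1 h2
    unfold N1
    have e := p_bound h (by linarith) h2 (-(Complex.I / 2)) (by simp)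
    have e2 : ‖Complex.exp (Complex.I * π * z ^ 2)‖ ≤ 1 := by
      rw [Complex.norm_exp, Real.exp_le_one_iff]
      simp [pow_two]
      have := mul_nonneg (mul_nonneg Real.pi_pos.le (by linarith : 0 ≤ z.re)) h1
      nlinarith
    rw [norm_mul]
    calc _ ≤ 3 * Real.exp z.re * 1 := by
          refine mul_le_mul ?_ e2 (norm_nonneg _) (by positivity)
          rw [sub_eq_add_neg, ← neg_mul]
          exact e
      _ = _ := mul_one _)

lemma strip_N2 :
    (∀ y : ℝ, (-1:ℝ) ≤ y → y ≤ (0:ℝ) → IntegrableOn (fun t : ℝ => N2 (t + y * Complex.I) / MM (t + y * Complex.I)) (Set.Ioi 0)) ∧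
    IntervalIntegrable (fun y : ℝ => N2 (y * Complex.I) / MM (y * Complex.I)) volume (-1:ℝ) (0:ℝ) ∧
    (∫ t in Set.Ioi (0:ℝ), N2 (t + (-1:ℝ) * Complex.I) / MM (t + (-1:ℝ) * Complex.I)) - (∫ t in Set.Ioi (0:ℝ), N2 (t + (0:ℝ) * Complex.I) / MM (t + (0:ℝ) * Complex.I))
      = Complex.I * ∫ y in (-1:ℝ)..(0:ℝ), N2 (y * Complex.I) / MM (y * Complex.I) := strip2 (N := N2) (a := -1) (b := 0) (by norm_num)
  (by unfold N2; fun_prop)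
  (by
    intro z h0 h1 hz
    obtain ⟨hr, n, hn⟩ := MM_zero hz
    have hn0 : -1 ≤ n := by rw [hn] at h0; exact_mod_cast h0
    have hn1 : n ≤ 0 := by rw [hn] at h1; exact_mod_cast h1
    have : n = 0 ∨ n = -1 := by omega
    unfold N2
    rcases this with rfl | rfl
    · have : z = 0 := by apply Complex.ext <;> simp [hr, hn]
      simp [this]
    · have : z = -Complex.I := by apply Complex.ext <;> simp [hr, hn]
      have e : -(π * -Complex.I) = π * Complex.I := by ring
      rw [this, e, Complex.exp_pi_mul_I]
      norm_num)
  (by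
    rintro n ⟨h1, h2⟩
    have h1 : -1 < n := by exact_mod_cast h1
    have h2 : n < 0 := by exact_mod_cast h2
    omega)
  (by
    intro z h h1 h2
    unfold N2
    have e := p_bound h (by linarith) (by linarith) ((Complex.I / 2)) (by simp)
    have e2 : ‖Complex.exp (Complex.I * π * z ^ 2 - 2 * π * z)‖ ≤ 1 := by
      rw [Complex.norm_exp, Real.exp_le_one_iff]
      simp [pow_two]
      have := mul_nonneg (mul_nonneg Real.pi_pos.le (by linarith : 0 ≤ z.re)) (by linarith : 0 ≤ z.im + 1)
      nlinarith
    rw [norm_mul]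
    calc _ ≤ 3 * Real.exp z.re * 1 := by
          refine mul_le_mul e e2 (norm_nonneg _) (by positivity)
      _ = _ := mul_one _)

/-- explicit horizontal term -/
noncomputable def KK (t : ℝ) : ℂ :=
  2 * (t * Complex.exp (Complex.I * π * t ^ 2 + (-(2 * π * (1:ℝ)) : ℂ) * t))
   + Complex.I * Complex.exp (Complex.I * π * t ^ 2 + (-(2 * π * (1:ℝ)) : ℂ) * t)
   - Complex.I * Complex.exp (Complex.I * π * t ^ 2 + (-(2 * π * (3 / 2 : ℝ)) : ℂ) * t)

lemma exp_two_pi_I' : Complex.exp (2 * π * Complex.I) = 1 := Complex.exp_two_pi_mul_I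

lemma horiz (t : ℝ) (ht : 0 < t) :
    N1 (t + (0:ℝ) * Complex.I) / MM (t + (0:ℝ) * Complex.I) - N1 (t + (1:ℝ) * Complex.I) / MM (t + (1:ℝ) * Complex.I)
    - (N2 (t + (-1:ℝ) * Complex.I) / MM (t + (-1:ℝ) * Complex.I) - N2 (t + (0:ℝ) * Complex.I) / MM (t + (0:ℝ) * Complex.I))
    = 4 * (t * Complex.exp (Complex.I * π * t ^ 2) / (Complex.exp (2 * π * t) - 1)) - KK t := by
  have hM : MM t ≠ 0 := by
    intro h
    have := (MM_zero h).1
    simp at this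
    exact ht.ne' this
  set v := Complex.exp (π * t) with hv
  have hv0 : v ≠ 0 := Complex.exp_ne_zero _
  have hu : Complex.exp (2 * π * t) = v ^ 2 := by
    rw [hv, ← Complex.exp_nat_mul]; congr 1; push_cast; ring
  have hMv : v ^ 2 - 1 ≠ 0 := by rw [← hu]; exact hM
  set E := Complex.exp (Complex.I * π * t ^ 2) with hE
  have m0 : MM (t + (0:ℝ) * Complex.I) = v ^ 2 - 1 := by simp [MM, hu]
  have m1 : MM (t + (1:ℝ) * Complex.I) = v ^ 2 - 1 := by
    have : 2 * π * (t + (1:ℝ) * Complex.I) = 2 * π * t + 2 * π * Complex.I := by push_cast; ring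
    rw [MM, this, Complex.exp_add, exp_two_pi_I', hu, mul_one]
  have m2 : MM (t + (-1:ℝ) * Complex.I) = v ^ 2 - 1 := by
    have : 2 * π * (t + (-1:ℝ) * Complex.I) = 2 * π * t - 2 * π * Complex.I := by push_cast; ring
    rw [MM, this, Complex.exp_sub, exp_two_pi_I', hu, div_one]
  have q0 : Complex.exp (-(π * t)) = v⁻¹ := by rw [Complex.exp_neg]
  have q1 : Complex.exp (-(π * (t + (1:ℝ) * Complex.I))) = - v⁻¹ := by
    have : -(π * (t + (1:ℝ) * Complex.I)) = -(π * t) - π * Complex.I := by push_cast; ring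
    rw [this, Complex.exp_sub, Complex.exp_pi_mul_I, q0]; ring
  have q2 : Complex.exp (-(π * (t + (-1:ℝ) * Complex.I))) = - v⁻¹ := by
    have : -(π * (t + (-1:ℝ) * Complex.I)) = -(π * t) + π * Complex.I := by push_cast; ring
    rw [this, Complex.exp_add, Complex.exp_pi_mul_I, q0]; ring
  have E1 : Complex.exp (Complex.I * π * (t + (1:ℝ) * Complex.I) ^ 2) = - E / v ^ 2 := by
    have : Complex.I * π * (t + (1:ℝ) * Complex.I) ^ 2 = Complex.I * π * t ^ 2 - 2 * π * t - π * Complex.I := by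
      push_cast; ring_nf; simp [Complex.I_sq, show Complex.I ^ 3 = -Complex.I from Complex.I_pow_three]; ring
    rw [this, Complex.exp_sub, Complex.exp_sub, Complex.exp_pi_mul_I, hu]; ring
  have E2 : Complex.exp (Complex.I * π * (t + (-1:ℝ) * Complex.I) ^ 2 - 2 * π * (t + (-1:ℝ) * Complex.I)) = - E := by
    have : Complex.I * π * (t + (-1:ℝ) * Complex.I) ^ 2 - 2 * π * (t + (-1:ℝ) * Complex.I) = Complex.I * π * t ^ 2 + π * Complex.I := by
      push_cast; ring_nf; simp [Complex.I_sq, show Complex.I ^ 3 = -Complex.I from Complex.I_pow_three]; ring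
    rw [this, Complex.exp_add, Complex.exp_pi_mul_I]; ring
  have E3 : Complex.exp (Complex.I * π * t ^ 2 - 2 * π * t) = E / v ^ 2 := by
    rw [Complex.exp_sub, hu]
  have X1 : Complex.exp (Complex.I * π * t ^ 2 + (-(2 * π * (1:ℝ)) : ℂ) * t) = E / v ^ 2 := by
    rw [← E3]; congr 1; push_cast; ring
  have X3 : Complex.exp (Complex.I * π * t ^ 2 + (-(2 * π * (3 / 2:ℝ)) : ℂ) * t) = E / v ^ 3 := by
    have : Complex.I * π * t ^ 2 + (-(2 * π * (3 / 2:ℝ)) : ℂ) * t = Complex.I * π * t ^ 2 - 2 * π * t - π * t := by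
      push_cast; ring
    rw [this, Complex.exp_sub, E3, ← hv]; field_simp
  have z0 : (t : ℂ) + (0:ℝ) * Complex.I = t := by simp
  rw [m0, m1, m2, KK, X1, X3, N1, N1, N2, N2, q1, q2, E1, E2, z0, q0, E3, hu, ← hE]
  push_cast
  field_simp
  ring

lemma vert (y : ℝ) (h0 : 0 < y) (h1 : y < 1) :
    N1 (y * Complex.I) / MM (y * Complex.I) - N2 ((-y : ℝ) * Complex.I) / MM ((-y : ℝ) * Complex.I)
    = -(Complex.I / 2) * Complex.exp (π * Complex.I / 4) * Complex.exp (-(Complex.I * π * (y + 1 / 2 : ℝ) ^ 2))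
      -(Complex.I / 2) * Complex.exp (π * Complex.I / 4) * Complex.exp (-(Complex.I * π * (y - 1 / 2 : ℝ) ^ 2))
      -(Complex.I / 2) * Complex.exp (π * Complex.I / 4) * Complex.exp (-(Complex.I * π * (y - 3 / 2 : ℝ) ^ 2))
      + (Complex.I / 2 - Complex.I * y) * Complex.exp (-(Complex.I * π * y ^ 2))
      + (Complex.I / 2 - Complex.I * (1 - y : ℝ)) * Complex.exp (-(Complex.I * π * (1 - y : ℝ) ^ 2)) := by
  have hM : MM (y * Complex.I) ≠ 0 := by
    intro h
    obtain ⟨n, hn⟩ := (MM_zero h).2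
    simp at hn
    rw [hn] at h0 h1
    have h0 : 0 < n := by exact_mod_cast h0
    have h1 : n < 1 := by exact_mod_cast h1
    omega
  set r := Complex.exp (π * (y * Complex.I)) with hr
  have hr0 : r ≠ 0 := Complex.exp_ne_zero _
  have hw : Complex.exp (2 * π * (y * Complex.I)) = r ^ 2 := by
    rw [hr, ← Complex.exp_nat_mul]; congr 1; push_cast; ring
  set E := Complex.exp (-(Complex.I * π * y ^ 2)) with hE
  have m0 : MM (y * Complex.I) = r ^ 2 - 1 := by rw [MM, hw]
  have m1 : MM ((-y : ℝ) * Complex.I) = (r ^ 2)⁻¹ - 1 := by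
    rw [MM, ← hw, ← Complex.exp_neg]; congr 2; push_cast; ring
  rw [m0] at hM
  have q0 : Complex.exp (-(π * (y * Complex.I))) = r⁻¹ := by rw [Complex.exp_neg]
  have q1 : Complex.exp (-(π * ((-y : ℝ) * Complex.I))) = r := by
    rw [hr]; congr 1; push_cast; ring
  have E0 : Complex.exp (Complex.I * π * (y * Complex.I) ^ 2) = E := by
    rw [hE]; congr 1; rw [mul_pow, Complex.I_sq]; ring
  have E1 : Complex.exp (Complex.I * π * ((-y : ℝ) * Complex.I) ^ 2 - 2 * π * ((-y : ℝ) * Complex.I)) = E * r ^ 2 := by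
    rw [hE, ← hw, ← Complex.exp_add]; congr 1; rw [mul_pow, Complex.I_sq]; push_cast; ring
  have A1 : Complex.exp (π * Complex.I / 4) * Complex.exp (-(Complex.I * π * (y + 1 / 2 : ℝ) ^ 2)) = E * r⁻¹ := by
    rw [← q0, hE, ← Complex.exp_add, ← Complex.exp_add]; congr 1; push_cast; ring
  have A2 : Complex.exp (π * Complex.I / 4) * Complex.exp (-(Complex.I * π * (y - 1 / 2 : ℝ) ^ 2)) = E * r := by
    rw [hr, hE, ← Complex.exp_add, ← Complex.exp_add]; congr 1; push_cast; ring
  have A3 : Complex.exp (π * Complex.I / 4) * Complex.exp (-(Complex.I * π * (y - 3 / 2 : ℝ) ^ 2)) = E * r ^ 3 := by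
    have : E * r ^ 3 = E * r ^ 2 * r / Complex.exp (2 * π * Complex.I) := by
      rw [exp_two_pi_I']; ring
    rw [this, ← hw, hr, hE, ← Complex.exp_add, ← Complex.exp_add, ← Complex.exp_add, ← Complex.exp_sub]
    congr 1; push_cast; ring
  have A4 : Complex.exp (-(Complex.I * π * (1 - y : ℝ) ^ 2)) = - (E * r ^ 2) := by
    have : -(E * r ^ 2) = E * r ^ 2 / Complex.exp (π * Complex.I) := by
      rw [Complex.exp_pi_mul_I]; ring
    rw [this, ← hw, hE, ← Complex.exp_add, ← Complex.exp_sub]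
    congr 1; push_cast; ring
  rw [mul_assoc, mul_assoc _ _ (Complex.exp (-(Complex.I * π * (y - 1 / 2 : ℝ) ^ 2))),
    mul_assoc _ _ (Complex.exp (-(Complex.I * π * (y - 3 / 2 : ℝ) ^ 2))), A1, A2, A3, A4,
    m0, m1, N1, N2, q0, q1, E0, E1]
  have hM' : (r ^ 2)⁻¹ - 1 = -(r ^ 2 - 1) / r ^ 2 := by field_simp; ring
  rw [hM']
  push_cast
  field_simp
  ring

noncomputable def Phi (a : ℝ) : ℂ := ∫ s in (0:ℝ)..a, Complex.exp (-(Complex.I * π * s ^ 2))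

lemma y_int : ∫ y in (0:ℝ)..1, (y:ℂ) * Complex.exp (-(Complex.I * π * y ^ 2)) = 1 / (π * Complex.I) := by
  have hpi : (π : ℂ) ≠ 0 := by exact_mod_cast Real.pi_ne_zero
  have hd : ∀ x ∈ Set.uIcc (0:ℝ) 1, HasDerivAt (fun x : ℝ => Complex.exp (-(Complex.I * π * x ^ 2)) * (-1 / (2 * π * Complex.I)))
      (x * Complex.exp (-(Complex.I * π * x ^ 2))) x := by
    intro x _
    have h0 : HasDerivAt (fun t : ℝ => (t : ℂ)) 1 x := Complex.ofRealCLM.hasDerivAt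
    have := ((((h0.pow 2).const_mul (Complex.I * π)).neg).cexp).mul_const (-1 / (2 * π * Complex.I))
    refine this.congr_deriv ?_
    simp
    field_simp
  rw [intervalIntegral.integral_eq_sub_of_hasDerivAt hd (Continuous.intervalIntegrable (by fun_prop) _ _)]
  have : -(Complex.I * π * ((1:ℝ):ℂ) ^ 2) = -(π * Complex.I) := by push_cast; ring
  rw [this, Complex.exp_neg, Complex.exp_pi_mul_I]
  simp
  field_simp
  norm_num

lemma vert_int :
    ∫ y in (0:ℝ)..1, (N1 (y * Complex.I) / MM (y * Complex.I) - N2 ((-y : ℝ) * Complex.I) / MM ((-y : ℝ) * Complex.I))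
    = - Complex.I * Complex.exp (π * Complex.I / 4) * Phi (3 / 2) + Complex.I * Phi 1 - 2 / π := by
  have hpi : (π : ℂ) ≠ 0 := by exact_mod_cast Real.pi_ne_zero
  set e : ℝ → ℂ := fun s => Complex.exp (-(Complex.I * π * (s:ℂ) ^ 2)) with he
  have hec : Continuous e := by fun_prop
  set k := -(Complex.I / 2) * Complex.exp (π * Complex.I / 4) with hk
  set L : ℝ → ℂ := fun y => (Complex.I / 2 - Complex.I * y) * e y with hL
  have hLc : Continuous L := by fun_prop
  have h1 : ∫ y in (0:ℝ)..1, (N1 (y * Complex.I) / MM (y * Complex.I) - N2 ((-y : ℝ) * Complex.I) / MM ((-y : ℝ) * Complex.I))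
      = ∫ y in (0:ℝ)..1, (k * e (y + 1 / 2) + k * e (y - 1 / 2) + k * e (y - 3 / 2) + L y + L (1 - y)) := by
    apply intervalIntegral.integral_congr_ae
    have : ∀ᵐ y : ℝ, y ≠ 1 := by simp [ae_iff]
    filter_upwards [this] with y hyb hy
    rw [Set.uIoc_of_le zero_le_one] at hy
    rw [vert y hy.1 (lt_of_le_of_ne hy.2 hyb)]
    simp only [hk, he, hL]
    ring
  have ii : ∀ f : ℝ → ℂ, Continuous f → ∀ a b : ℝ, IntervalIntegrable f volume a b := fun f hf a b => hf.intervalIntegrable a b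
  rw [h1, intervalIntegral.integral_add (ii _ (by fun_prop) _ _) (ii _ (by fun_prop) _ _),
    intervalIntegral.integral_add (ii _ (by fun_prop) _ _) (ii _ (by fun_prop) _ _),
    intervalIntegral.integral_add (ii _ (by fun_prop) _ _) (ii _ (by fun_prop) _ _),
    intervalIntegral.integral_add (ii _ (by fun_prop) _ _) (ii _ (by fun_prop) _ _),
    intervalIntegral.integral_const_mul, intervalIntegral.integral_const_mul, intervalIntegral.integral_const_mul,
    intervalIntegral.integral_comp_add_right, intervalIntegral.integral_comp_sub_right,
    intervalIntegral.integral_comp_sub_right, intervalIntegral.integral_comp_sub_left]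
  have hLi : ∫ y in (0:ℝ)..1, L y = Complex.I / 2 * Phi 1 - Complex.I * (1 / (π * Complex.I)) := by
    have : ∀ y, L y = Complex.I / 2 * e y - Complex.I * (y * e y) := by intro y; simp only [hL]; ring
    simp_rw [this]
    rw [intervalIntegral.integral_sub (ii _ (by fun_prop) _ _) (ii _ (by fun_prop) _ _),
      intervalIntegral.integral_const_mul, intervalIntegral.integral_const_mul, y_int]
    rfl
  have hsum : (∫ x in (0 + 1 / 2 : ℝ)..(1 + 1 / 2), e x) + (∫ x in (0 - 1 / 2 : ℝ)..(1 - 1 / 2), e x)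
      + (∫ x in (0 - 3 / 2 : ℝ)..(1 - 3 / 2), e x) = 2 * Phi (3 / 2) := by
    have a1 := intervalIntegral.integral_add_adjacent_intervals (ii e hec (-(3/2)) (-(1/2))) (ii e hec (-(1/2)) (1/2))
    have a2 := intervalIntegral.integral_add_adjacent_intervals (ii e hec (-(3/2)) (1/2)) (ii e hec (1/2) (3/2))
    have a3 := intervalIntegral.integral_add_adjacent_intervals (ii e hec (-(3/2)) 0) (ii e hec 0 (3/2))
    have a4 : ∫ x in (-(3/2) : ℝ)..0, e x = ∫ x in (0:ℝ)..(3/2), e x := by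
      have := intervalIntegral.integral_comp_neg (a := 0) (b := 3/2) e
      rw [neg_zero] at this
      rw [← this]
      congr 1
      ext x
      simp [he]
    have a5 : (∫ x in (0:ℝ)..(3/2), e x) = Phi (3/2) := rfl
    norm_num
    norm_num at a1 a2 a3 a4 a5
    linear_combination a1 + a2 - a3 + a4 + 2 * a5
  have hz : (1 - 1 : ℝ) = 0 := by norm_num
  rw [hz, sub_zero, hLi, ← mul_add, ← mul_add, hsum, hk]
  field_simp
  ring

lemma X_int {a : ℝ} (ha : 0 < a) :
    IntegrableOn (fun t : ℝ => Complex.exp (Complex.I * π * t ^ 2 + (-(2 * π * a) : ℂ) * t)) (Set.Ioi 0) := by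
  have h := integrableOn_exp_mul_Ioi (a := -(2 * π * a)) (by nlinarith [Real.pi_pos, mul_pos Real.pi_pos ha]) 0
  refine Integrable.mono' h (by fun_prop) (Filter.Eventually.of_forall ?_)
  intro t
  rw [Complex.norm_exp]
  apply Real.exp_le_exp.mpr
  have e : (Complex.I * π * t ^ 2 + -(2 * π * a) * t : ℂ) = ((-(2 * π * a) * t : ℝ) : ℂ) + ((π * t ^ 2 : ℝ) : ℂ) * Complex.I := by
    push_cast; ring
  rw [e, Complex.add_re, Complex.re_ofReal_mul, Complex.ofReal_re, Complex.I_re]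
  simp

lemma tX_int :
    IntegrableOn (fun t : ℝ => (t:ℂ) * Complex.exp (Complex.I * π * t ^ 2 + (-(2 * π * (1:ℝ)) : ℂ) * t)) (Set.Ioi 0) := by
  have h := integrableOn_exp_mul_Ioi (a := -1) (by norm_num) 0
  refine Integrable.mono' h (by fun_prop) ?_
  refine (ae_restrict_iff' measurableSet_Ioi).mpr (Filter.Eventually.of_forall ?_)
  intro t ht
  have ht : (0:ℝ) < t := ht
  have e : (Complex.I * π * t ^ 2 + -(2 * π * (1:ℝ)) * t : ℂ) = ((-(2 * π) * t : ℝ) : ℂ) + ((π * t ^ 2 : ℝ) : ℂ) * Complex.I := by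
    push_cast; ring
  rw [norm_mul, Complex.norm_exp, Complex.norm_real, Real.norm_of_nonneg ht.le, e, Complex.add_re,
    Complex.re_ofReal_mul, Complex.ofReal_re, Complex.I_re, mul_zero, add_zero]
  have h1 : t ≤ Real.exp t := by linarith [Real.add_one_le_exp t]
  calc t * Real.exp (-(2 * π) * t) ≤ Real.exp t * Real.exp (-(2 * π) * t) := by gcongr
    _ = Real.exp (t + -(2 * π) * t) := by rw [Real.exp_add]
    _ ≤ _ := by
      apply Real.exp_le_exp.mpr
      nlinarith [Real.pi_gt_three]

noncomputable def H0 (a : ℝ) : ℂ :=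
  ∫ t in Set.Ioi (0:ℝ), Complex.exp (Complex.I * π * t ^ 2 + (-(2 * π * a) : ℂ) * t)

lemma tX_val : ∫ t in Set.Ioi (0:ℝ), (t:ℂ) * Complex.exp (Complex.I * π * t ^ 2 + (-(2 * π * (1:ℝ)) : ℂ) * t)
    = (2 * π * H0 1 - 1) / (2 * π * Complex.I) := by
  have hpi : (π : ℂ) ≠ 0 := by exact_mod_cast Real.pi_ne_zero
  have h1 := tX_int
  have h2 := X_int one_pos
  have hder : ∀ t ∈ Set.Ici (0:ℝ), HasDerivAt (fun t : ℝ => Complex.exp (Complex.I * π * t ^ 2 + (-(2 * π * (1:ℝ)) : ℂ) * t))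
      ((2 * π * Complex.I) * ((t:ℂ) * Complex.exp (Complex.I * π * t ^ 2 + (-(2 * π * (1:ℝ)) : ℂ) * t)) +
       (-(2 * π)) * Complex.exp (Complex.I * π * t ^ 2 + (-(2 * π * (1:ℝ)) : ℂ) * t)) t := by
    intro t _
    have h0 : HasDerivAt (fun t : ℝ => (t : ℂ)) 1 t := Complex.ofRealCLM.hasDerivAt
    have := (((h0.pow 2).const_mul (Complex.I * π)).add (h0.const_mul (-(2 * π * (1:ℝ)) : ℂ))).cexp
    refine this.congr_deriv ?_
    simp
    ring
  have hint := (h1.const_mul (2 * π * Complex.I)).add (h2.const_mul (-(2 * π) : ℂ))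
  have ht := tendsto_zero_of_hasDerivAt_of_integrableOn_Ioi (a := 0) (fun t ht => hder t (Set.mem_Ici.mpr (le_of_lt ht))) hint h2
  have := integral_Ioi_of_hasDerivAt_of_tendsto' hder hint ht
  rw [integral_add (h1.const_mul _) (h2.const_mul _), integral_const_mul, integral_const_mul] at this
  have e0 : Complex.exp (Complex.I * π * ((0:ℝ):ℂ) ^ 2 + (-(2 * π * (1:ℝ)) : ℂ) * (0:ℝ)) = 1 := by simp
  rw [e0] at this
  rw [eq_div_iff (by simp [hpi])]
  unfold H0
  linear_combination this

lemma KK_int : IntegrableOn KK (Set.Ioi 0) := by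
  unfold KK
  exact ((tX_int.const_mul 2).add ((X_int one_pos).const_mul _)).sub ((X_int (by norm_num)).const_mul _)

lemma KK_val : ∫ t in Set.Ioi (0:ℝ), KK t = Complex.I / π - Complex.I * H0 1 - Complex.I * H0 (3 / 2) := by
  have hpi : (π : ℂ) ≠ 0 := by exact_mod_cast Real.pi_ne_zero
  have k1 := tX_int.const_mul 2
  have k2 := (X_int one_pos).const_mul Complex.I
  have k3 := (X_int (show (0:ℝ) < 3 / 2 by norm_num)).const_mul Complex.I
  have s1 := integral_sub (k1.add k2) k3
  have s2 := integral_add k1 k2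
  simp only [Pi.add_apply] at s1
  unfold KK
  rw [s1, s2, integral_const_mul, integral_const_mul, integral_const_mul, tX_val]
  change 2 * _ + Complex.I * H0 1 - Complex.I * H0 (3 / 2) = _
  field_simp
  rw [Complex.I_sq]
  ring

lemma J_all : IntegrableOn (fun t : ℝ => (t:ℂ) * Complex.exp (Complex.I * π * t ^ 2) / (Complex.exp (2 * π * t) - 1)) (Set.Ioi 0) ∧
    4 * ∫ t in Set.Ioi (0:ℝ), (t:ℂ) * Complex.exp (Complex.I * π * t ^ 2) / (Complex.exp (2 * π * t) - 1)
     = (∫ t in Set.Ioi (0:ℝ), KK t) + Complex.I *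
       (- Complex.I * Complex.exp (π * Complex.I / 4) * Phi (3 / 2) + Complex.I * Phi 1 - 2 / π) := by
  obtain ⟨a1, b1, c1⟩ := strip_N1
  obtain ⟨a2, b2, c2⟩ := strip_N2
  have i1 := a1 0 le_rfl zero_le_one
  have i2 := a1 1 zero_le_one le_rfl
  have i3 := a2 (-1) le_rfl (by norm_num)
  have i4 := a2 0 (by norm_num) le_rfl
  have hI := (i1.sub i2).sub (i3.sub i4)
  have hI2 := (hI.add KK_int).const_mul (1 / 4)
  have hJ : IntegrableOn (fun t : ℝ => (t:ℂ) * Complex.exp (Complex.I * π * t ^ 2) / (Complex.exp (2 * π * t) - 1)) (Set.Ioi 0) := by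
    refine IntegrableOn.congr_fun hI2 ?_ measurableSet_Ioi
    intro t ht
    have := horiz t ht
    simp only [Pi.sub_apply, Pi.add_apply]
    rw [this]; ring
  refine ⟨hJ, ?_⟩
  have e1 := integral_sub (i1.sub i2) (i3.sub i4)
  have e2 := integral_sub i1 i2
  have e3 := integral_sub i3 i4
  have e4 : ∫ t in Set.Ioi (0:ℝ), (N1 (t + (0:ℝ) * Complex.I) / MM (t + (0:ℝ) * Complex.I) - N1 (t + (1:ℝ) * Complex.I) / MM (t + (1:ℝ) * Complex.I)
    - (N2 (t + (-1:ℝ) * Complex.I) / MM (t + (-1:ℝ) * Complex.I) - N2 (t + (0:ℝ) * Complex.I) / MM (t + (0:ℝ) * Complex.I)))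
    = 4 * (∫ t in Set.Ioi (0:ℝ), (t:ℂ) * Complex.exp (Complex.I * π * t ^ 2) / (Complex.exp (2 * π * t) - 1)) - ∫ t in Set.Ioi (0:ℝ), KK t := by
    rw [← integral_const_mul, ← integral_sub (hJ.const_mul 4) KK_int]
    exact setIntegral_congr_fun measurableSet_Ioi (fun t ht => horiz t ht)
  have b2' : IntervalIntegrable (fun y : ℝ => N2 ((-y : ℝ) * Complex.I) / MM ((-y : ℝ) * Complex.I)) volume 0 1 := by
    have := (IntervalIntegrable.comp_sub_left b2 0).symm
    simpa using this
  have e5 := intervalIntegral.integral_sub b1 b2'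
  have e6 := intervalIntegral.integral_comp_neg (a := 0) (b := 1) (fun y : ℝ => N2 (y * Complex.I) / MM (y * Complex.I))
  rw [neg_zero] at e6
  rw [vert_int] at e5
  simp only [Pi.sub_apply] at e1 e2 e3
  rw [e4, e2, e3, c1, c2, ← e6] at e1
  linear_combination e1 - Complex.I * e5

lemma omega_val : Complex.I ^ (1 / 2 : ℂ) = Complex.exp (π * Complex.I / 4) := by
  rw [Complex.cpow_def_of_ne_zero Complex.I_ne_zero, Complex.log_I]
  congr 1; ring

lemma J_val : 4 * ∫ t in Set.Ioi (0:ℝ), (t:ℂ) * Complex.exp (Complex.I * π * t ^ 2) / (Complex.exp (2 * π * t) - 1)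
    = Complex.I * Complex.exp (π * Complex.I / 4) / 2 + 1 / 2 - Complex.I / π := by
  have hpi : (π : ℂ) ≠ 0 := by exact_mod_cast Real.pi_ne_zero
  rw [J_all.2, KK_val]
  have f1 := H_formula one_pos
  have f2 := H_formula (show (0:ℝ) < 3 / 2 by norm_num)
  change _ * H0 1 = _ - _ * Phi 1 at f1
  change _ * H0 (3 / 2) = _ - _ * Phi (3 / 2) at f2
  rw [omega_val] at f1 f2
  set ω := Complex.exp (π * Complex.I / 4) with hω
  have w2 : ω ^ 2 = Complex.I := by
    rw [hω, ← Complex.exp_nat_mul]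
    have : ((2:ℕ):ℂ) * (π * Complex.I / 4) = π / 2 * Complex.I := by push_cast; ring
    rw [this, Complex.exp_pi_div_two_mul_I]
  have g1 : Complex.exp (-(Complex.I * π * ((1:ℝ):ℂ) ^ 2)) = -1 := by
    have : -(Complex.I * π * ((1:ℝ):ℂ) ^ 2) = -(π * Complex.I) := by push_cast; ring
    rw [this, Complex.exp_neg, Complex.exp_pi_mul_I]; norm_num
  have g2 : ω * Complex.exp (-(Complex.I * π * ((3 / 2:ℝ):ℂ) ^ 2)) = 1 := by
    rw [hω, ← Complex.exp_add]
    have : π * Complex.I / 4 + -(Complex.I * π * ((3 / 2:ℝ):ℂ) ^ 2) = -(2 * π * Complex.I) := by push_cast; ring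
    rw [this, Complex.exp_neg, exp_two_pi_I', inv_one]
  rw [g1] at f1
  have f3 : H0 (3 / 2) = ω * (ω / 2 - Complex.I * Phi (3 / 2)) := by
    rw [← f2, ← mul_assoc, g2, one_mul]
  have f4 : H0 1 = -(ω / 2 - Complex.I * Phi 1) := by rw [← f1]; ring
  rw [f3, f4]
  have hI := Complex.I_sq
  field_simp
  linear_combination (-Complex.I * π) * w2 + (-π) * hI

theorem stmt11 :
    ∫ x in Set.Ioi (0:ℝ), Real.cos (π * x) / (Real.exp (2 * π * Real.sqrt x) - 1) = (2 - Real.sqrt 2) / 8 := by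
  rw [← integral_comp_rpow_Ioi_of_pos (p := 2) two_pos]
  have hJ := J_all.1
  have h1 := integral_re hJ
  have h2 : ∫ x in Set.Ioi (0:ℝ), ((2:ℝ) * x ^ ((2:ℝ) - 1)) • (Real.cos (π * x ^ (2:ℝ)) / (Real.exp (2 * π * Real.sqrt (x ^ (2:ℝ))) - 1))
      = 2 * ∫ t in Set.Ioi (0:ℝ), RCLike.re ((t:ℂ) * Complex.exp (Complex.I * π * t ^ 2) / (Complex.exp (2 * π * t) - 1)) := by
    rw [← integral_const_mul]
    refine setIntegral_congr_fun measurableSet_Ioi ?_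
    intro t ht
    have ht : (0:ℝ) < t := ht
    have e1 : Complex.exp (Complex.I * π * t ^ 2) = Complex.exp (((π * t ^ 2 : ℝ) : ℂ) * Complex.I) := by
      congr 1; push_cast; ring
    have e2 : Complex.exp (2 * π * t) - 1 = ((Real.exp (2 * π * t) - 1 : ℝ) : ℂ) := by push_cast; rfl
    simp only [e1, e2]
    rw [Real.rpow_two, Real.sqrt_sq ht.le]
    have e3 : RCLike.re ((t:ℂ) * Complex.exp (((π * t ^ 2 : ℝ) : ℂ) * Complex.I) / ((Real.exp (2 * π * t) - 1 : ℝ) : ℂ))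
        = t * Real.cos (π * t ^ 2) / (Real.exp (2 * π * t) - 1) := by
      change Complex.re _ = _
      rw [Complex.div_ofReal_re, Complex.re_ofReal_mul, Complex.exp_ofReal_mul_I_re]
    rw [e3]
    norm_num
    ring
  rw [h2, h1]
  have h3 := congrArg Complex.re J_val
  have e4 : Complex.exp (π * Complex.I / 4) = ((Real.sqrt 2 / 2 : ℝ) : ℂ) + ((Real.sqrt 2 / 2 : ℝ) : ℂ) * Complex.I := by
    have : (π : ℂ) * Complex.I / 4 = ((π / 4 : ℝ) : ℂ) * Complex.I := by push_cast; ring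
    rw [this, Complex.exp_mul_I, ← Complex.ofReal_cos, ← Complex.ofReal_sin, Real.cos_pi_div_four, Real.sin_pi_div_four]
  have e5 : Complex.I * Complex.exp (π * Complex.I / 4) / 2 + 1 / 2 - Complex.I / π
      = ((1 / 2 - Real.sqrt 2 / 4 : ℝ) : ℂ) + ((Real.sqrt 2 / 4 - 1 / π : ℝ) : ℂ) * Complex.I := by
    rw [e4]; push_cast
    linear_combination (Real.sqrt 2 / 4 : ℂ) * Complex.I_sq
  rw [e5, Complex.add_re, Complex.re_ofReal_mul, Complex.ofReal_re, Complex.I_re, mul_zero, add_zero] at h3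
  have e6 : ∀ z : ℂ, (4 * z).re = 4 * z.re := by intro z; simp
  rw [e6] at h3
  change 2 * Complex.re _ = _
  linarith
end

section
/- ∫₀^∞ cos(2π x)/(exp(2π√x) − 1) dx = 1/16. -/
open Real MeasureTheory

noncomputable def bc (g : ℝ → ℝ) (n : ℤ) : ℝ := (1/2) * ∫ s in (-1:ℝ)..1, g s * Real.cos (π * n * s)

lemma odd_int (h : ℝ → ℝ) (ho : ∀ x, h (-x) = - h x) : ∫ s in (-1:ℝ)..1, h s = 0 := by
  have h1 := intervalIntegral.integral_comp_neg (a := -1) (b := 1) h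
  simp only [ho, intervalIntegral.integral_neg, neg_neg] at h1
  linarith

lemma bc_hasSum (g : ℝ → ℝ) (hg : Continuous g) (he : ∀ x, g (-x) = g x) (C : ℝ)
    (hC : ∀ n : ℤ, n ≠ 0 → |bc g n| ≤ C / (n:ℝ)^2) (x : ℝ) (hx : x ∈ Set.Ico (-1:ℝ) 1) :
    HasSum (fun n : ℤ => bc g n * Real.cos (π * n * x)) (g x) := by
  have : Fact ((0:ℝ) < 2) := ⟨by norm_num⟩
  let G : C(AddCircle (2:ℝ), ℂ) := ⟨AddCircle.liftIco 2 (-1) (fun s => (g s : ℂ)),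
    AddCircle.liftIco_continuous (by
      have := he 1
      norm_num [this]) (by fun_prop)⟩
  have hco : ∀ n, fourierCoeff G n = (bc g n : ℂ) := by
    intro n
    rw [fourierCoeff_eq_intervalIntegral _ _ (-1)]
    have h1 : ∫ x in (-1:ℝ)..(-1+2), (fourier (-n) (x : AddCircle (2:ℝ))) • G x =
        ∫ x in (-1:ℝ)..1, (((g x * Real.cos (π * n * x) : ℝ) : ℂ) -
          ((g x * Real.sin (π * n * x) : ℝ) : ℂ) * Complex.I) := by
      rw [show (-1:ℝ)+2 = 1 by norm_num]
      refine intervalIntegral.integral_congr_Ioo_of_le (by norm_num) fun s hs => ?_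
      have : G s = g s := by
        change AddCircle.liftIco 2 (-1) (fun s => (g s : ℂ)) s = _
        rw [AddCircle.liftIco_coe_apply]
        constructor <;> [exact hs.1.le; (have := hs.2; linarith)]
      rw [this, fourier_coe_apply]
      have h2 : 2 * (π:ℂ) * Complex.I * ((-n : ℤ) : ℂ) * s / (2:ℝ) = ((-(π * n * s) : ℝ) : ℂ) * Complex.I := by
        push_cast; ring
      rw [h2, Complex.exp_mul_I, ← Complex.ofReal_cos, ← Complex.ofReal_sin, Real.cos_neg, Real.sin_neg]
      push_cast
      rw [smul_eq_mul]
      ring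
    rw [h1, intervalIntegral.integral_sub, intervalIntegral.integral_mul_const,
      intervalIntegral.integral_ofReal, intervalIntegral.integral_ofReal,
      odd_int (fun s => g s * Real.sin (π * n * s))]
    · simp [bc]
    · intro s; simp [he]
    · apply Continuous.intervalIntegrable; fun_prop
    · apply Continuous.intervalIntegrable; fun_prop
  have hs : Summable (fourierCoeff G) := by
    have h3 : Summable (fun n : ℤ => C / (n:ℝ)^2) := by
      have := (Real.summable_one_div_int_pow (p := 2)).2 (by norm_num)
      simpa [div_eq_mul_inv] using this.mul_left C
    refine Summable.of_norm_bounded_eventually h3 ?_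
    have : ∀ᶠ n : ℤ in Filter.cofinite, n ≠ 0 := by
      exact Filter.eventually_cofinite_ne 0
    filter_upwards [this] with n hn
    rw [hco]
    simpa using hC n hn
  have h5 := has_pointwise_sum_fourier_series_of_summable hs (x : AddCircle (2:ℝ))
  have h6 := Complex.hasSum_re h5
  have : G x = g x := by
    change AddCircle.liftIco 2 (-1) (fun s => (g s : ℂ)) x = _
    rw [AddCircle.liftIco_coe_apply]
    constructor <;> [exact hx.1; (have := hx.2; linarith)]
  rw [this] at h6
  convert! h6 using 2 with n
  rw [hco, fourier_coe_apply]
  have h2 : 2 * (π:ℂ) * Complex.I * (n : ℂ) * x / (2:ℝ) = (((π * n * x) : ℝ) : ℂ) * Complex.I := by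
    push_cast; ring
  rw [h2, smul_eq_mul, Complex.re_ofReal_mul, Complex.exp_ofReal_mul_I_re]

lemma bc_parts (g g1 g2 : ℝ → ℝ) (h1 : ∀ x, HasDerivAt g (g1 x) x) (h2 : ∀ x, HasDerivAt g1 (g2 x) x)
    (hc : Continuous g2) (n : ℤ) (hn : n ≠ 0) :
    bc g n = - (1 / (π * n)^2) * (bc g2 n - (g1 1 - g1 (-1)) / 2 * Real.cos (π * n)) := by
  have hn' : (n:ℝ) ≠ 0 := by exact_mod_cast hn
  have hp : π * (n:ℝ) ≠ 0 := mul_ne_zero pi_ne_zero hn'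
  have c1 : Continuous g1 := continuous_iff_continuousAt.2 fun x => (h2 x).continuousAt
  have c0 : Continuous g := continuous_iff_continuousAt.2 fun x => (h1 x).continuousAt
  -- derivative of  g sin/(πn) + g1 cos/(πn)^2
  have key : ∀ x, HasDerivAt (fun x => g x * (Real.sin (π * n * x) / (π * n)) + g1 x * (Real.cos (π * n * x) / (π * n)^2))
      (g x * Real.cos (π * n * x) + g2 x * Real.cos (π * n * x) / (π*n)^2) x := by
    intro x
    have hl : HasDerivAt (fun x : ℝ => π * n * x) (π * n) x := by
      simpa using (hasDerivAt_id x).const_mul (π * n)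
    have := ((h1 x).mul ((hl.sin).div_const (π * n))).add ((h2 x).mul ((hl.cos).div_const ((π * n)^2)))
    convert! this using 1
    field_simp
    ring
  have hI := intervalIntegral.integral_eq_sub_of_hasDerivAt (a := -1) (b := 1) (fun x _ => key x)
    (by apply Continuous.intervalIntegrable; fun_prop)
  rw [intervalIntegral.integral_add (by apply Continuous.intervalIntegrable; fun_prop)
    (by apply Continuous.intervalIntegrable; fun_prop), intervalIntegral.integral_div] at hI
  have hsin : Real.sin (π * n) = 0 := by rw [mul_comm]; exact Real.sin_int_mul_pi n
  simp only [mul_one, mul_neg, Real.sin_neg, Real.cos_neg, hsin] at hI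
  unfold bc
  rw [eq_sub_of_add_eq hI]
  field_simp
  ring

noncomputable def ff (s : ℝ) : ℝ := Real.sin (π * s^2 / 2)
noncomputable def f1 (s : ℝ) : ℝ := π * s * Real.cos (π * s^2 / 2)
noncomputable def f2 (s : ℝ) : ℝ := π * Real.cos (π * s^2 / 2) - π^2 * s^2 * Real.sin (π * s^2 / 2)
noncomputable def f3 (s : ℝ) : ℝ := -3*π^2 * s * Real.sin (π * s^2 / 2) - π^3 * s^3 * Real.cos (π * s^2 / 2)
noncomputable def f4 (s : ℝ) : ℝ := -3*π^2 * Real.sin (π * s^2 / 2) - 6 * π^3 * s^2 * Real.cos (π * s^2 / 2)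
  + π^4 * s^4 * Real.sin (π * s^2 / 2)

lemma hsq (s : ℝ) : HasDerivAt (fun s : ℝ => π * s^2 / 2) (π * s) s := by
  have := ((hasDerivAt_pow 2 s).const_mul π).div_const 2
  convert! this using 1
  simp; ring

lemma d1 (s : ℝ) : HasDerivAt ff (f1 s) s := by
  convert! (hsq s).sin using 1
  unfold f1; ring
lemma d2 (s : ℝ) : HasDerivAt f1 (f2 s) s := by
  convert! ((hasDerivAt_id s).const_mul π).mul (hsq s).cos using 1
  simp [f2]; ring
lemma d3 (s : ℝ) : HasDerivAt f2 (f3 s) s := by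
  convert! ((hsq s).cos.const_mul π).sub (((hasDerivAt_pow 2 s).const_mul (π^2)).mul (hsq s).sin) using 1
  simp [f3]; ring
lemma d4 (s : ℝ) : HasDerivAt f3 (f4 s) s := by
  convert! (((hasDerivAt_id s).const_mul (-3*π^2)).mul (hsq s).sin).sub (((hasDerivAt_pow 3 s).const_mul (π^3)).mul (hsq s).cos) using 1
  simp [f4]; ring

lemma bc_bound (g : ℝ → ℝ) (hg : Continuous g) : ∃ M, 0 ≤ M ∧ ∀ n, |bc g n| ≤ M := by
  refine ⟨(1/2) * ∫ s in (-1:ℝ)..1, |g s|, ?_, fun n => ?_⟩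
  · have := intervalIntegral.integral_nonneg (a := -1) (b := 1) (μ := volume) (f := fun s => |g s|) (by norm_num) (fun s _ => abs_nonneg _)
    linarith
  · unfold bc
    rw [abs_mul, abs_of_pos (by norm_num : (0:ℝ) < 1/2)]
    gcongr
    refine (intervalIntegral.abs_integral_le_integral_abs (by norm_num)).trans ?_
    apply intervalIntegral.integral_mono_on (by norm_num)
    · apply Continuous.intervalIntegrable; fun_prop
    · apply Continuous.intervalIntegrable; fun_prop
    · intro s _
      rw [abs_mul]
      exact mul_le_of_le_one_right (abs_nonneg _) (Real.abs_cos_le_one _)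

lemma bc_decay (g g1 g2 : ℝ → ℝ) (h1 : ∀ x, HasDerivAt g (g1 x) x) (h2 : ∀ x, HasDerivAt g1 (g2 x) x)
    (hc : Continuous g2) : ∃ C, ∀ n : ℤ, n ≠ 0 → |bc g n| ≤ C / (n:ℝ)^2 := by
  obtain ⟨M, hM, h⟩ := bc_bound g2 hc
  refine ⟨(M + |(g1 1 - g1 (-1)) / 2|) / π^2, fun n hn => ?_⟩
  rw [bc_parts g g1 g2 h1 h2 hc n hn, abs_mul, abs_neg, abs_of_nonneg (by positivity)]
  have : |bc g2 n - (g1 1 - g1 (-1)) / 2 * Real.cos (π * n)| ≤ M + |(g1 1 - g1 (-1)) / 2| := by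
    refine (abs_sub _ _).trans (add_le_add (h n) ?_)
    rw [abs_mul]
    exact mul_le_of_le_one_right (abs_nonneg _) (Real.abs_cos_le_one _)
  calc _ ≤ 1 / (π * n)^2 * (M + |(g1 1 - g1 (-1)) / 2|) := by gcongr
    _ = _ := by rw [mul_pow]; field_simp

lemma cneg (n : ℤ) : Real.cos (π * n * (-1)) = Real.cos (π * n) := by
  rw [mul_neg_one, Real.cos_neg]

lemma sum_A : HasSum (fun n : ℤ => (n:ℝ)^2 * Real.cos (π * n) * bc ff n) 1 := by
  obtain ⟨C, hC⟩ := bc_decay f2 f3 f4 d3 d4 (by unfold f4; fun_prop)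
  have h := bc_hasSum f2 (by unfold f2; fun_prop) (by intro x; simp [f2]) C hC (-1) (by norm_num)
  have h' := h.mul_left (-(1/π^2))
  have e1 : -(1/π^2) * f2 (-1) = 1 := by
    simp [f2, pi_ne_zero]
  rw [e1] at h'
  convert! h' using 2 with n
  rw [cneg]
  by_cases hn : n = 0
  · subst hn
    have : bc f2 0 = 0 := by
      unfold bc
      have := intervalIntegral.integral_eq_sub_of_hasDerivAt (a := -1) (b := 1) (fun x _ => d2 x)
        (by apply Continuous.intervalIntegrable; unfold f2; fun_prop)
      simp [this, f1]
    simp [this]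
  · rw [bc_parts ff f1 f2 d1 d2 (by unfold f2; fun_prop) n hn]
    have hn' : (n:ℝ) ≠ 0 := by exact_mod_cast hn
    simp [f1]
    field_simp

lemma sum_B : HasSum (fun n : ℤ => (1 - Real.cos (π * n)) * bc ff n) (-1) := by
  obtain ⟨C, hC⟩ := bc_decay ff f1 f2 d1 d2 (by unfold f2; fun_prop)
  have h := bc_hasSum ff (by unfold ff; fun_prop) (by intro x; simp [ff]) C hC (-1) (by norm_num)
  have h0 := bc_hasSum ff (by unfold ff; fun_prop) (by intro x; simp [ff]) C hC 0 (by norm_num)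
  have := h0.sub h
  convert! this using 1
  · funext n
    rw [cneg]; simp; ring
  · simp [ff]

lemma bc_neg (g : ℝ → ℝ) (n : ℤ) : bc g (-n) = bc g n := by
  unfold bc; simp

/-- the weights -/
noncomputable def pw (n : ℕ) : ℝ := (n:ℝ)^2/4 + ((-1)^n - 1)/8

lemma cos_pw (n : ℕ) : Real.cos (π * n) = (-1)^n := by
  rw [mul_comm]; exact Real.cos_nat_mul_pi n

lemma sum_C : HasSum (fun n : ℕ => pw n * (-1)^n * bc ff n) (1/16) := by
  have h := (sum_A.mul_left (1/4)).add (sum_B.mul_left (1/8))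
  have h2 := (HasSum.nat_add_neg h).mul_left (1/2)
  convert! h2 using 1
  · funext n
    rw [bc_neg]
    push_cast
    have : Real.cos (π * -(n:ℝ)) = Real.cos (π * n) := by simp
    rw [this, cos_pw, pw]
    have : ((-1:ℝ)^n)^2 = 1 := by rw [← pow_mul, mul_comm, pow_mul]; simp
    linear_combination (1/8) * bc ff n * this
  · norm_num

noncomputable def Ph (y t : ℝ) : ℂ := Complex.exp (2 * π * Complex.I * t^2 - 2 * π * y * t)
noncomputable def WW (y : ℝ) : ℂ := ∫ t in Set.Ioi (0:ℝ), Ph y t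

lemma Ph_eq (y t : ℝ) : Ph y t = ((Real.exp (-(2*π*y)*t) * Real.cos (2*π*t^2) : ℝ) : ℂ)
    + ((Real.exp (-(2*π*y)*t) * Real.sin (2*π*t^2) : ℝ) : ℂ) * Complex.I := by
  unfold Ph
  have : 2 * (π:ℂ) * Complex.I * t^2 - 2 * π * y * t = ((-(2*π*y)*t : ℝ) : ℂ) + ((2*π*t^2 : ℝ):ℂ) * Complex.I := by
    push_cast; ring
  rw [this, Complex.exp_add, Complex.exp_mul_I, ← Complex.ofReal_cos, ← Complex.ofReal_sin, ← Complex.ofReal_exp]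
  push_cast; ring

lemma Ph_im (y t : ℝ) : (Ph y t).im = Real.exp (-(2*π*y)*t) * Real.sin (2*π*t^2) := by
  rw [Ph_eq]; simp only [Complex.add_im, Complex.ofReal_im, Complex.im_ofReal_mul, Complex.I_im]; ring

lemma Ph_norm (y t : ℝ) : ‖Ph y t‖ = Real.exp (-(2*π*y)*t) := by
  unfold Ph
  rw [Complex.norm_exp]
  congr 1
  have : 2 * (π:ℂ) * Complex.I * t^2 - 2 * π * y * t = ((-(2*π*y)*t : ℝ) : ℂ) + ((2*π*t^2 : ℝ):ℂ) * Complex.I := by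
    push_cast; ring
  rw [this]; simp only [Complex.add_re, Complex.ofReal_re, Complex.re_ofReal_mul, Complex.I_re]; ring

lemma Ph_cont (y : ℝ) : Continuous (Ph y) := by unfold Ph; fun_prop

lemma int_exp {a : ℝ} (ha : 0 < a) : IntegrableOn (fun t => Real.exp (-a * t)) (Set.Ioi 0) :=
  exp_neg_integrableOn_Ioi 0 ha

lemma int_texp {a : ℝ} (ha : 0 < a) : IntegrableOn (fun t => t * Real.exp (-a * t)) (Set.Ioi 0) := by
  refine Integrable.mono' ((int_exp (half_pos ha)).const_mul (2/a)) (by fun_prop) ?_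
  refine (ae_restrict_iff' measurableSet_Ioi).2 (ae_of_all _ fun t ht => ?_)
  have ht : 0 < t := ht
  rw [Real.norm_of_nonneg (by positivity)]
  have h1 : t ≤ 2/a * Real.exp (a/2*t) := by
    have := Real.add_one_le_exp (a/2*t)
    rw [div_mul_eq_mul_div, le_div_iff₀ ha]; linarith
  calc t * Real.exp (-a*t) ≤ (2/a * Real.exp (a/2*t)) * Real.exp (-a*t) := by gcongr
    _ = _ := by rw [mul_assoc, ← Real.exp_add]; ring_nf

lemma val_texp {a : ℝ} (ha : 0 < a) : ∫ t in Set.Ioi 0, t * Real.exp (-a * t) = 1/a^2 := by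
  have := Real.integral_rpow_mul_exp_neg_mul_Ioi (a := 2) (r := a) (by norm_num) ha
  rw [show (2:ℝ) - 1 = 1 by norm_num, Real.Gamma_two] at this
  simp only [Real.rpow_one, mul_one] at this
  rw [show (2:ℝ) = (2:ℕ) by norm_num, Real.rpow_natCast, one_div_pow] at this
  rw [← this]
  simp

lemma Ph_int {y : ℝ} (hy : 0 < y) : IntegrableOn (Ph y) (Set.Ioi 0) := by
  refine Integrable.mono' (int_exp (a := 2*π*y) (by positivity)) (Ph_cont y).aestronglyMeasurable ?_
  exact ae_of_all _ fun t => (Ph_norm y t).le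

lemma tPh_int {y : ℝ} (hy : 0 < y) : IntegrableOn (fun t : ℝ => (t:ℂ) * Ph y t) (Set.Ioi 0) := by
  have hc := Ph_cont y
  refine Integrable.mono' (int_texp (a := 2*π*y) (by positivity)) (by fun_prop) ?_
  refine (ae_restrict_iff' measurableSet_Ioi).2 (ae_of_all _ fun t ht => ?_)
  have ht : 0 < t := ht
  rw [norm_mul, Ph_norm, Complex.norm_real, Real.norm_of_nonneg ht.le]

lemma Ph_dt (y t : ℝ) : HasDerivAt (Ph y) ((4 * π * Complex.I) * (t * Ph y t) - 2 * π * y * Ph y t) t := by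
  have h0 : HasDerivAt (fun t : ℝ => (t:ℂ)) 1 t := Complex.ofRealCLM.hasDerivAt
  have := (((h0.pow 2).const_mul (2 * π * Complex.I)).sub (h0.const_mul (2 * π * y : ℂ))).cexp
  convert! this using 1
  simp [Ph]; ring

lemma Ph_tendsto {y : ℝ} (hy : 0 < y) : Filter.Tendsto (Ph y) Filter.atTop (nhds 0) := by
  rw [tendsto_zero_iff_norm_tendsto_zero]
  simp only [Ph_norm]
  have hp : 0 < 2*π*y := by positivity
  refine Real.tendsto_exp_atBot.comp ?_
  exact Filter.tendsto_id.const_mul_atTop_of_neg (by linarith)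

lemma E_eq {y : ℝ} (hy : 0 < y) :
    (4 * π * Complex.I) * (∫ t in Set.Ioi (0:ℝ), (t:ℂ) * Ph y t) - 2 * π * y * WW y = -1 := by
  have h := integral_Ioi_of_hasDerivAt_of_tendsto' (a := 0) (fun t _ => Ph_dt y t)
    (((tPh_int hy).const_mul _).sub ((Ph_int hy).const_mul _)) (Ph_tendsto hy)
  rw [integral_sub ((tPh_int hy).const_mul _) ((Ph_int hy).const_mul _), integral_const_mul, integral_const_mul] at h
  rw [WW, h]; simp [Ph]

lemma W_deriv {y : ℝ} (hy : 0 < y) :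
    HasDerivAt WW (-(2 * π) * ∫ t in Set.Ioi (0:ℝ), (t:ℂ) * Ph y t) y := by
  have hc := Ph_cont y
  have h := hasDerivAt_integral_of_dominated_loc_of_deriv_le (μ := volume.restrict (Set.Ioi (0:ℝ)))
    (F := Ph) (F' := fun y t => -(2 * π) * ((t:ℂ) * Ph y t)) (x₀ := y) (s := Set.Ioi (y/2))
    (bound := fun t => 2 * π * (t * Real.exp (-(2*π*(y/2)) * t)))
    (Ioi_mem_nhds (by linarith)) (Filter.Eventually.of_forall fun z => (Ph_cont z).aestronglyMeasurable)
    (Ph_int hy) (by fun_prop) ?_ ((int_texp (by positivity)).const_mul _) ?_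
  · rw [← integral_const_mul]
    exact h.2
  · refine (ae_restrict_iff' measurableSet_Ioi).2 (ae_of_all _ fun t ht => ?_)
    intro x hx
    have ht : 0 < t := ht
    have hx : y/2 < x := hx
    rw [norm_mul, norm_mul, Ph_norm, Complex.norm_real, Real.norm_of_nonneg ht.le]
    have : ‖(-(2 * π) : ℂ)‖ = 2 * π := by
      simp [abs_of_pos pi_pos]
    rw [this]
    gcongr
  · refine ae_of_all _ fun t x _ => ?_
    have h0 : HasDerivAt (fun t : ℝ => (t:ℂ)) 1 x := Complex.ofRealCLM.hasDerivAt
    have := ((((h0.const_mul (2 * π : ℂ)).mul_const (t:ℂ))).const_sub (2 * π * Complex.I * t^2)).cexp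
    convert! this using 1
    simp [Ph]; ring

noncomputable def ee (y : ℝ) : ℂ := Complex.exp (-(Complex.I * π * y^2 / 2))

lemma V_deriv {y : ℝ} (hy : 0 < y) :
    HasDerivAt (fun y => ee y * WW y) (-(Complex.I/2) * ee y) y := by
  have h0 : HasDerivAt (fun t : ℝ => (t:ℂ)) 1 y := Complex.ofRealCLM.hasDerivAt
  have h1 := ((((h0.pow 2).const_mul (Complex.I * π)).div_const 2).neg).cexp
  have h2 := h1.mul (W_deriv hy)
  have hE := E_eq hy
  convert! h2 using 1
  simp only [ee]
  simp
  linear_combination (-Complex.I/2 * Complex.exp (-(Complex.I * π * y^2 / 2))) * hE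
    + (2 * π * (∫ t in Set.Ioi (0:ℝ), (t:ℂ) * Ph y t) * Complex.exp (-(Complex.I * π * y^2 / 2))) * Complex.I_sq

lemma re_E {y : ℝ} (hy : 0 < y) :
    ∫ t in Set.Ioi (0:ℝ), 2 * t * Real.cos (2*π*t^2) * Real.exp (-(2*π*y)*t) = y * (WW y).im := by
  have hE := congrArg Complex.im (E_eq hy)
  have h1 : (∫ t in Set.Ioi (0:ℝ), (t:ℂ) * Ph y t).re =
      ∫ t in Set.Ioi (0:ℝ), t * (Real.exp (-(2*π*y)*t) * Real.cos (2*π*t^2)) := by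
    have := integral_re (tPh_int hy)
    simp only [RCLike.re_eq_complex_re] at this
    rw [← this]
    congr 1; ext t
    rw [Complex.re_ofReal_mul, Ph_eq]
    simp only [Complex.add_re, Complex.ofReal_re, Complex.re_ofReal_mul, Complex.I_re]; ring
  have h2 : (fun t : ℝ => 2 * t * Real.cos (2*π*t^2) * Real.exp (-(2*π*y)*t)) =
      fun t => 2 * (t * (Real.exp (-(2*π*y)*t) * Real.cos (2*π*t^2))) := by
    ext t; ring
  rw [h2, integral_const_mul, ← h1]
  set J := ∫ t in Set.Ioi (0:ℝ), (t:ℂ) * Ph y t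
  have e : (4 * π * Complex.I) * J - 2 * π * y * WW y = ((4*π : ℝ) : ℂ) * (Complex.I * J) - ((2 * π * y : ℝ):ℂ) * WW y := by
    push_cast; ring
  rw [e, Complex.sub_im, Complex.im_ofReal_mul, Complex.im_ofReal_mul, Complex.I_mul_im] at hE
  simp at hE
  have := pi_pos
  apply mul_left_cancel₀ (mul_ne_zero two_ne_zero this.ne')
  linarith

lemma termbd {y : ℝ} (hy : 0 < y) :
    Integrable (fun t => 2 * t * Real.cos (2*π*t^2) * Real.exp (-(2*π*y)*t)) (volume.restrict (Set.Ioi (0:ℝ))) ∧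
    ∫ t in Set.Ioi (0:ℝ), ‖2 * t * Real.cos (2*π*t^2) * Real.exp (-(2*π*y)*t)‖ ≤ 1 / y^2 := by
  have hi := (int_texp (a := 2*π*y) (by positivity)).const_mul 2
  have hb : ∀ t ∈ Set.Ioi (0:ℝ), ‖2 * t * Real.cos (2*π*t^2) * Real.exp (-(2*π*y)*t)‖ ≤ 2 * (t * Real.exp (-(2*π*y)*t)) := by
    intro t ht
    have ht : 0 < t := ht
    rw [norm_mul, norm_mul, norm_mul, Real.norm_of_nonneg ht.le, Real.norm_of_nonneg (Real.exp_pos _).le, Real.norm_two, Real.norm_eq_abs]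
    have := Real.abs_cos_le_one (2*π*t^2)
    calc _ ≤ 2 * t * 1 * Real.exp (-(2*π*y)*t) := by gcongr
      _ = _ := by ring
  have h1 : Integrable (fun t => 2 * t * Real.cos (2*π*t^2) * Real.exp (-(2*π*y)*t)) (volume.restrict (Set.Ioi (0:ℝ))) := by
    refine Integrable.mono' hi (by fun_prop) ?_
    exact (ae_restrict_iff' measurableSet_Ioi).2 (ae_of_all _ hb)
  refine ⟨h1, (setIntegral_mono_on h1.norm hi measurableSet_Ioi hb).trans ?_⟩
  rw [integral_const_mul, val_texp (by positivity)]
  have := pi_gt_three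
  rw [mul_one_div, div_le_div_iff₀ (by positivity) (by positivity)]
  rw [mul_pow]
  have h2 : (2:ℝ) ≤ (2*π)^2 := by nlinarith
  rw [one_mul]
  gcongr

lemma w_bd {y : ℝ} (hy : 0 < y) : |(WW y).im| ≤ 1 / y^3 := by
  have h := (norm_integral_le_integral_norm _).trans (termbd hy).2
  rw [re_E hy, Real.norm_eq_abs, abs_mul, abs_of_pos hy] at h
  rw [le_div_iff₀ (by positivity)] at h ⊢
  calc _ = y * |(WW y).im| * y^2 := by ring
    _ ≤ 1 := h

lemma main_sum : HasSum (fun n : ℕ => ((n:ℝ)+1) * (WW (n+1)).im)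
    (∫ x in Set.Ioi (0:ℝ), Real.cos (2 * π * x) / (Real.exp (2 * π * Real.sqrt x) - 1)) := by
  have h := hasSum_integral_of_summable_integral_norm (μ := volume.restrict (Set.Ioi (0:ℝ)))
    (F := fun (n:ℕ) t => 2 * t * Real.cos (2*π*t^2) * Real.exp (-(2*π*((n:ℝ)+1))*t))
    (fun n => (termbd (by positivity)).1) (by
      refine Summable.of_nonneg_of_le (fun n => integral_nonneg fun t => norm_nonneg _)
        (fun n => (termbd (by positivity)).2) ?_
      have := (summable_nat_add_iff 1).2 ((Real.summable_one_div_nat_pow (p := 2)).2 (by norm_num))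
      simpa using this)
  convert! h using 1
  · funext n
    rw [re_E (by positivity)]
  · rw [← integral_comp_rpow_Ioi_of_pos (p := 2) (by norm_num)]
    refine setIntegral_congr_fun measurableSet_Ioi fun t ht => ?_
    have ht : 0 < t := ht
    rw [tsum_mul_left]
    have hg : ∑' n : ℕ, Real.exp (-(2*π*((n:ℝ)+1))*t) = 1 / (Real.exp (2*π*t) - 1) := by
      have e : ∀ n : ℕ, Real.exp (-(2*π*((n:ℝ)+1))*t) = Real.exp (-(2*π*t)) * Real.exp (-(2*π*t))^n := by
        intro n
        rw [← Real.exp_nat_mul, ← Real.exp_add]; ring_nf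
      simp only [e]
      have hlt : Real.exp (-(2*π*t)) < 1 := by
        rw [Real.exp_lt_one_iff]; have := pi_pos; simp; positivity
      rw [tsum_mul_left, tsum_geometric_of_lt_one (Real.exp_pos _).le hlt]
      rw [Real.exp_neg] at hlt ⊢
      have hE := Real.exp_pos (2*π*t)
      have : Real.exp (2*π*t) - 1 ≠ 0 := by
        have : 1 < Real.exp (2*π*t) := by rw [Real.one_lt_exp_iff]; positivity
        linarith
      have : 1 - (Real.exp (2*π*t))⁻¹ ≠ 0 := by linarith
      field_simp
    rw [hg]
    simp only [Real.rpow_two, Real.sqrt_sq ht.le, smul_eq_mul]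
    rw [show (2:ℝ) - 1 = 1 by norm_num, Real.rpow_one]
    ring

lemma ee_shift (m : ℕ) (s : ℝ) : -(Complex.I/2) * ee (m + s) =
    ee (m - 1) * ((-1)^m / 2) * (((Real.cos (π * m * s + π * s^2/2) : ℝ) : ℂ) -
      ((Real.sin (π * m * s + π * s^2/2) : ℝ) : ℂ) * Complex.I) := by
  have h1 : ee (m + s) = ee (m - 1) * Complex.exp (m * (-(π * Complex.I))) * Complex.exp (π / 2 * Complex.I) *
      Complex.exp (((-(π * m * s + π * s^2/2) : ℝ) : ℂ) * Complex.I) := by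
    unfold ee
    rw [← Complex.exp_add, ← Complex.exp_add, ← Complex.exp_add]
    congr 1
    push_cast
    ring
  rw [h1, Complex.exp_nat_mul, Complex.exp_neg, Complex.exp_pi_mul_I, Complex.exp_pi_div_two_mul_I,
    Complex.exp_mul_I, ← Complex.ofReal_cos, ← Complex.ofReal_sin, Real.cos_neg, Real.sin_neg, inv_neg_one]
  push_cast
  linear_combination (-(1/2) * ee (m - 1) * (-1)^m * (Complex.cos (π * m * s + π * s^2/2) - Complex.sin (π * m * s + π * s^2/2) * Complex.I)) * Complex.I_sq

lemma ee_per (m : ℕ) : ee (m + 1) = ee (m - 1) := by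
  unfold ee
  rw [Complex.exp_eq_exp_iff_exists_int]
  refine ⟨-m, ?_⟩
  push_cast
  ring

lemma diffW (m : ℕ) (hm : 2 ≤ m) :
    (WW ((m:ℝ) - 1)).im - (WW ((m:ℝ) + 1)).im = (-1)^m * bc ff m := by
  have hm' : (2:ℝ) ≤ m := by exact_mod_cast hm
  have hee : Continuous ee := by unfold ee; fun_prop
  have h := intervalIntegral.integral_eq_sub_of_hasDerivAt (a := (m:ℝ) + -1) (b := m + 1)
    (f := fun y => ee y * WW y) (f' := fun y => -(Complex.I/2) * ee y)
    (fun y hy => V_deriv (by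
      rw [Set.uIcc_of_le (by linarith)] at hy
      linarith [hy.1])) (by apply Continuous.intervalIntegrable; fun_prop)
  rw [← intervalIntegral.integral_comp_add_left] at h
  simp only [ee_shift] at h
  rw [← sub_eq_add_neg, ee_per, intervalIntegral.integral_const_mul, ← mul_sub, mul_assoc] at h
  have hne : ee ((m:ℝ) - 1) ≠ 0 := Complex.exp_ne_zero _
  have h := mul_left_cancel₀ hne h
  rw [intervalIntegral.integral_sub (by apply Continuous.intervalIntegrable; fun_prop)
    (by apply Continuous.intervalIntegrable; fun_prop), intervalIntegral.integral_mul_const,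
      intervalIntegral.integral_ofReal, intervalIntegral.integral_ofReal] at h
  have hs : ∫ s in (-1:ℝ)..1, Real.sin (π * m * s + π * s^2/2) = 2 * bc ff m := by
    simp only [Real.sin_add]
    rw [intervalIntegral.integral_add (by apply Continuous.intervalIntegrable; fun_prop)
      (by apply Continuous.intervalIntegrable; fun_prop),
      odd_int (fun s => Real.sin (π * m * s) * Real.cos (π * s^2/2)) (by intro x; simp)]
    unfold bc ff
    rw [zero_add, ← mul_assoc]
    norm_num
    congr 1; ext s; ring
  rw [hs] at h
  have h := congrArg Complex.im h
  rw [show ((-1:ℂ)^m/2) = (((-1)^m/2 : ℝ) : ℂ) by push_cast; rfl, Complex.im_ofReal_mul, Complex.sub_im,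
    Complex.ofReal_im, Complex.im_ofReal_mul, Complex.I_im, Complex.sub_im] at h
  linarith

lemma pw_step (n : ℕ) : pw (n + 2) = pw n + (n + 1) := by
  unfold pw; push_cast; ring

lemma telescope (N : ℕ) : ∑ m ∈ Finset.range (N + 2), pw m * (-1)^m * bc ff m =
    ∑ n ∈ Finset.range N, ((n:ℝ)+1) * (WW (n+1)).im - pw N * (WW (N+1)).im - pw (N+1) * (WW ((N+1:ℕ)+1)).im := by
  induction N with
  | zero => simp [Finset.sum_range_succ, pw]; norm_num
  | succ N ih =>
    rw [show N + 1 + 2 = (N + 2) + 1 by ring, Finset.sum_range_succ, ih, Finset.sum_range_succ]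
    have hd := diffW (N + 2) (by omega)
    rw [mul_assoc, ← hd, show N + 1 + 1 = N + 2 by ring, pw_step]
    push_cast
    rw [show (N:ℝ) + 2 - 1 = N + 1 by ring]
    ring

lemma pw_tendsto : Filter.Tendsto (fun N : ℕ => pw N * (WW ((N:ℝ)+1)).im) Filter.atTop (nhds 0) := by
  refine squeeze_zero_norm (fun N => ?_) (tendsto_one_div_add_atTop_nhds_zero_nat (𝕜 := ℝ))
  rw [norm_mul, Real.norm_eq_abs, Real.norm_eq_abs]
  have hN : (0:ℝ) < (N:ℝ) + 1 := by positivity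
  have h1 := w_bd hN
  have h2 : |pw N| ≤ ((N:ℝ)+1)^2 := by
    unfold pw
    have hN0 : (0:ℝ) ≤ N := by positivity
    rcases neg_one_pow_eq_or ℝ N with h | h <;> rw [h, abs_le] <;> constructor <;> nlinarith
  calc _ ≤ ((N:ℝ)+1)^2 * (1 / ((N:ℝ)+1)^3) := by gcongr
    _ = _ := by field_simp

theorem stmt12 :
    ∫ x in Set.Ioi (0:ℝ), Real.cos (2 * π * x) / (Real.exp (2 * π * Real.sqrt x) - 1) = 1 / 16 := by
  have h1 := (sum_C.tendsto_sum_nat).comp (Filter.tendsto_add_atTop_nat 2)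
  have h2 := (main_sum.tendsto_sum_nat.sub pw_tendsto).sub (pw_tendsto.comp (Filter.tendsto_add_atTop_nat 1))
  rw [sub_zero, sub_zero] at h2
  refine tendsto_nhds_unique h2 (h1.congr fun N => ?_)
  exact telescope N
end
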